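/- arXiv:2312.01819 — 2 statements merged into one kernel-verified Lean document; each statement's English description precedes it below -/
import Mathlib

section
/- For every α ∈ [0.93, 2] and every t ∈ (0, t_α), ∂⁴ĥ_α(p(·,t))/∂t⁴ ≤ 0, where ĥ_α is the Tsallis entropy of order α. -/
open MeasureTheory Real Filter
open scoped Classical

/-- The density `p(x,t)` of `X + √t Z` along the heat flow. -/
noncomputable def heatP (f : ℝ → ℝ) (t x : ℝ) : ℝ :=
  ∫ y : ℝ, f y * ((Real.sqrt (2 * Real.pi * t))⁻¹ * Real.exp (-(x - y) ^ 2 / (2 * t)))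

/-- `p_k(x,t) = ∂^k p / ∂x^k`. -/
noncomputable def pk (f : ℝ → ℝ) (k : ℕ) (t x : ℝ) : ℝ :=
  iteratedDeriv k (heatP f t) x

/-- `p̄_i = p_i / p`. -/
noncomputable def pbar (f : ℝ → ℝ) (i : ℕ) (t x : ℝ) : ℝ :=
  pk f i t x / heatP f t x

/-- The Rényi entropy `h_α(p(·,t))`, with the Shannon entropy at `α = 1`. -/
noncomputable def renyiEnt (f : ℝ → ℝ) (α t : ℝ) : ℝ :=
  if α = 1 then -∫ x : ℝ, heatP f t x * Real.log (heatP f t x)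
  else (1 - α)⁻¹ * Real.log (∫ x : ℝ, heatP f t x ^ α)

/-- Finiteness `|h_α(p(·,t))| < ∞` of the Rényi entropy at time `t`. -/
def renyiFinite (f : ℝ → ℝ) (α t : ℝ) : Prop :=
  if α = 1 then Integrable (fun x : ℝ => heatP f t x * Real.log (heatP f t x))
  else Integrable (fun x : ℝ => heatP f t x ^ α) ∧ 0 < ∫ x : ℝ, heatP f t x ^ α

/-- `t < t_α` where `t_α = sup { s > 0 : |h_α(p(·,s))| < ∞ }`. -/
def ltTalpha (f : ℝ → ℝ) (α t : ℝ) : Prop :=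
  ∃ s : ℝ, t < s ∧ 0 < s ∧ renyiFinite f α s

/-- The tilted expectation `E_α[g] = (∫ g p^α) / (∫ p^α)`. -/
noncomputable def Ea (f : ℝ → ℝ) (α t : ℝ) (g : ℝ → ℝ) : ℝ :=
  (∫ x : ℝ, g x * heatP f t x ^ α) / (∫ x : ℝ, heatP f t x ^ α)

/-- The Tsallis entropy along the heat flow, Shannon entropy at order 1. -/
noncomputable def tsallisEnt (f : ℝ → ℝ) (α t : ℝ) : ℝ :=
  if α = 1 then -∫ x : ℝ, heatP f t x * Real.log (heatP f t x)
  else (1 - α)⁻¹ * ((∫ x : ℝ, heatP f t x ^ α) - 1)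

/-- The parametrised Gram form of the certificate. -/
noncomputable def gramQ (α y0 y1 y2 y3 y4 y5 y6 y7 x1 x2 x3 x4 x5 : ℝ) : ℝ :=
  (8)*x1*x1 + ((-48) + 24*α)*x1*x2 + ((-20) + 10*α)*x1*x3 + (60 + (-50)*α + 10*α^2)*x1*x4 + ((-24) + 26*α + (-9)*α^2 + 1*α^3)*x1*x5 + (36 + (-30)*α + 6*α^2)*x2*x2 + ((-36) + 30*α + (-6)*α^2)*x2*x3 + (24 + (-26)*α + 9*α^2 + (-1)*α^3)*x3*x4
  + y0*((4)*x1*x2 + ((-1))*x1*x3 + ((-6) + 2*α)*x2*x2 + (3 + (-1)*α)*x2*x3)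
  + y1*(((-1))*x1*x4 + ((-1))*x2*x2 + ((-2))*x2*x3 + (4 + (-1)*α)*x2*x4)
  + y2*(((-1))*x1*x5 + ((-4))*x2*x4 + (5 + (-1)*α)*x2*x5)
  + y3*(((-3))*x2*x3 + ((-1))*x3*x3 + (4 + (-1)*α)*x3*x4)
  + y4*(((-2))*x2*x4 + ((-3))*x3*x4 + (5 + (-1)*α)*x3*x5)
  + y5*(((-1))*x2*x5 + ((-5))*x3*x5 + (6 + (-1)*α)*x4*x5)
  + y6*(((-7))*x4*x5 + (7 + (-1)*α)*x5*x5)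
  + y7*((2)*x3*x5 + ((-2))*x4*x4)

lemma certA0 (x1 x2 x3 x4 x5 : ℝ) :
    0 ≤ 8*x1*x1 + (-2647/125)*x1*x2 + (-5913/500)*x1*x3 + (28857/1000)*x1*x4 + (-9073743/1000000)*x1*x5 + (191697/12500)*x2*x2 + (779271/50000)*x2*x3 + (-986739/25000)*x2*x4 + (594359/50000)*x2*x5 + (547/125)*x3*x3 + (-21304577/1000000)*x3*x4 + (67143/10000)*x3*x5 + (6587/250)*x4*x4 + (-102039/6250)*x4*x5 + (129291/50000)*x5*x5 := by
  have h : 8*x1*x1 + (-2647/125)*x1*x2 + (-5913/500)*x1*x3 + (28857/1000)*x1*x4 + (-9073743/1000000)*x1*x5 + (191697/12500)*x2*x2 + (779271/50000)*x2*x3 + (-986739/25000)*x2*x4 + (594359/50000)*x2*x5 + (547/125)*x3*x3 + (-21304577/1000000)*x3*x4 + (67143/10000)*x3*x5 + (6587/250)*x4*x4 + (-102039/6250)*x4*x5 + (129291/50000)*x5*x5 =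
      8*(x1 + (-2647/2000)*x2 + (-5913/8000)*x3 + (28857/16000)*x4 + (-9073743/16000000)*x5)^2
      + (661271/500000)*(x2 + (-66291/2645084)*x3 + (-2554641/5290168)*x4 + (-243837721/5290168000)*x5)^2
      + (312330439/66127100000)*(x3 + (-10129395989/12493217560)*x4 + (244097822589/499728702400)*x5)^2
      + (688736830177449/49972870240000000)*(x4 + (-5434151720320667/9183157735699320)*x5)^2
      + (63620883752308782646863/15305262892832200000000000)*(x5)^2 := by ring
  rw [h]; positivity

lemma certA1 (x1 x2 x3 x4 x5 : ℝ) :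
    0 ≤ 8*x1*x1 + (-211021/12500)*x1*x2 + (-412979/50000)*x1*x3 + (56056/3125)*x1*x4 + (-224171/50000)*x1*x5 + (28677847/2500000)*x2*x2 + (47290253/5000000)*x2*x3 + (-57916111/2500000)*x2*x4 + (27033939/5000000)*x2*x5 + (114487/50000)*x3*x3 + (-53979409/5000000)*x3*x4 + (3018337/1000000)*x3*x5 + (72319/5000)*x4*x4 + (-46580553/5000000)*x4*x5 + (10075819/5000000)*x5*x5 := by
  have h : 8*x1*x1 + (-211021/12500)*x1*x2 + (-412979/50000)*x1*x3 + (56056/3125)*x1*x4 + (-224171/50000)*x1*x5 + (28677847/2500000)*x2*x2 + (47290253/5000000)*x2*x3 + (-57916111/2500000)*x2*x4 + (27033939/5000000)*x2*x5 + (114487/50000)*x3*x3 + (-53979409/5000000)*x3*x4 + (3018337/1000000)*x3*x5 + (72319/5000)*x4*x4 + (-46580553/5000000)*x4*x5 + (10075819/5000000)*x5*x5 =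
      8*(x1 + (-211021/200000)*x2 + (-412979/800000)*x3 + (7007/6250)*x4 + (-224171/800000)*x5)^2
      + (12825831559/5000000000)*(x2 + (7433264441/51303326236)*x3 + (-10600138296/12825831559)*x4 + (6763089409/51303326236)*x5)^2
      + (53352676046748727/513033262360000000)*(x3 + (-21490637170976202/4850243276977157)*x4 + (155423348438743661/53352676046748727)*x5)^2
      + (5963183466373168585839/9700486553954314000000)*(x4 + (-25368430358095463209507/29815917331865842929195)*x5)^2
      + (12200589342678802069040217017/819937726626310680552862500000)*(x5)^2 := by ring
  rw [h]; positivity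

lemma certA2 (x1 x2 x3 x4 x5 : ℝ) :
    0 ≤ 8*x1*x1 + (-2992937/250000)*x1*x2 + (-4847063/1000000)*x1*x3 + (4652339/500000)*x1*x4 + (-9264817/5000000)*x1*x5 + (354321319/50000000)*x2*x2 + (436175561/100000000)*x2*x3 + (-515212333/50000000)*x2*x4 + (904973719/500000000)*x2*x5 + (4552123/5000000)*x3*x3 + (-2117353861/500000000)*x3*x4 + (63574621/50000000)*x3*x5 + (14822837/2500000)*x4*x4 + (-2166477177/500000000)*x4*x5 + (9201533/7812500)*x5*x5 := by
  have h : 8*x1*x1 + (-2992937/250000)*x1*x2 + (-4847063/1000000)*x1*x3 + (4652339/500000)*x1*x4 + (-9264817/5000000)*x1*x5 + (354321319/50000000)*x2*x2 + (436175561/100000000)*x2*x3 + (-515212333/50000000)*x2*x4 + (904973719/500000000)*x2*x5 + (4552123/5000000)*x3*x3 + (-2117353861/500000000)*x3*x4 + (63574621/50000000)*x3*x5 + (14822837/2500000)*x4*x4 + (-2166477177/500000000)*x4*x5 + (9201533/7812500)*x5*x5 =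
      8*(x1 + (-2992937/4000000)*x2 + (-4847063/16000000)*x3 + (4652339/8000000)*x4 + (-9264817/80000000)*x5)^2
      + (5215180874031/2000000000000)*(x2 + (2940068245969/20860723496124)*x3 + (-2228111930119/3476787249354)*x4 + (8469935162471/104303617480620)*x5)^2
      + (519184078435463929751/4172144699224800000000)*(x3 + (-9855615426288442316394/2595920392177319648755)*x4 + (6784598251063055890849/2595920392177319648755)*x5)^2
      + (116490241893876391073541711417/324490049022164956094375000000)*(x4 + (-333856145622108952984710936373/465960967575505564294166845668)*x5)^2
      + (22128264862567051661787838766403050761/1164902418938763910735417114170000000000)*(x5)^2 := by ring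
  rw [h]; positivity

lemma certA3 (x1 x2 x3 x4 x5 : ℝ) :
    0 ≤ 8*x1*x1 + (-1611551/250000)*x1*x2 + (-1588449/1000000)*x1*x3 + (1478637/500000)*x1*x4 + (-2619351/5000000)*x1*x5 + (7462491/2500000)*x2*x2 + (-525759/5000000)*x2*x3 + (-3754899/2500000)*x2*x4 + (1767781/25000000)*x2*x5 + (1190269/5000000)*x3*x3 + (-10860809/25000000)*x3*x4 + (717951/5000000)*x3*x5 + (1860011/2500000)*x4*x4 + (-16079973/25000000)*x4*x5 + (84357/390625)*x5*x5 := by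
  have h : 8*x1*x1 + (-1611551/250000)*x1*x2 + (-1588449/1000000)*x1*x3 + (1478637/500000)*x1*x4 + (-2619351/5000000)*x1*x5 + (7462491/2500000)*x2*x2 + (-525759/5000000)*x2*x3 + (-3754899/2500000)*x2*x4 + (1767781/25000000)*x2*x5 + (1190269/5000000)*x3*x3 + (-10860809/25000000)*x3*x4 + (717951/5000000)*x3*x5 + (1860011/2500000)*x4*x4 + (-16079973/25000000)*x4*x5 + (84357/390625)*x5*x5 =
      8*(x1 + (-1611551/4000000)*x2 + (-1588449/16000000)*x3 + (1478637/8000000)*x4 + (-2619351/80000000)*x5)^2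
      + (3372896174399/2000000000000)*(x2 + (-2980473774399/13491584697596)*x3 + (-621020264013/6745792348798)*x4 + (-2806992923401/67457923487980)*x5)^2
      + (16600337842218667/215865355161536000)*(x3 + (-70640527725808967014/51876055756933334375)*x4 + (20431738153691233131/51876055756933334375)*x5)^2
      + (50874107965853311273502439/162112674240416669921875000)*(x4 + (-25765383551206985070617179/33916071977235540849001626)*x5)^2
      + (16136469460848969379691399062961/1413169665718147535375067750000000)*(x5)^2 := by ring
  rw [h]; positivity

lemma certB0 (x1 x2 x3 x4 x5 : ℝ) :
    0 ≤ 40*x1*x1 + (-20)*x1*x2 + (-11)*x1*x3 + (141/10)*x1*x4 + (-67/50)*x1*x5 + (69/10)*x2*x2 + (3/2)*x2*x3 + (-41/50)*x2*x4 + (-203/50)*x2*x5 + (11/10)*x3*x3 + (-47/25)*x3*x4 + (17/50)*x3*x5 + (12/5)*x4*x4 + (-63/25)*x4*x5 + (39/25)*x5*x5 := by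
  have h : 40*x1*x1 + (-20)*x1*x2 + (-11)*x1*x3 + (141/10)*x1*x4 + (-67/50)*x1*x5 + (69/10)*x2*x2 + (3/2)*x2*x3 + (-41/50)*x2*x4 + (-203/50)*x2*x5 + (11/10)*x3*x3 + (-47/25)*x3*x4 + (17/50)*x3*x5 + (12/5)*x4*x4 + (-63/25)*x4*x5 + (39/25)*x5*x5 =
      40*(x1 + (-1/4)*x2 + (-11/80)*x3 + (141/800)*x4 + (-67/4000)*x5)^2
      + (22/5)*(x2 + (-25/176)*x3 + (541/1760)*x4 + (-879/1760)*x5)^2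
      + (359/1408)*(x3 + (15593/17950)*x4 + (-82463/89750)*x5)^2
      + (3943901/7180000)*(x4 + (-9438931/19719505)*x5)^2
      + (108631319/985975250)*(x5)^2 := by ring
  rw [h]; positivity

lemma certB1 (x1 x2 x3 x4 x5 : ℝ) :
    0 ≤ 40*x1*x1 + (-20)*x1*x2 + (-11)*x1*x3 + (131/10)*x1*x4 + (-1)*x1*x5 + (13/2)*x2*x2 + 2*x2*x3 + (-61/100)*x2*x4 + (-393/100)*x2*x5 + (11/10)*x3*x3 + (-211/100)*x3*x4 + (27/100)*x3*x5 + (12/5)*x4*x4 + (-251/100)*x4*x5 + (153/100)*x5*x5 := by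
  have h : 40*x1*x1 + (-20)*x1*x2 + (-11)*x1*x3 + (131/10)*x1*x4 + (-1)*x1*x5 + (13/2)*x2*x2 + 2*x2*x3 + (-61/100)*x2*x4 + (-393/100)*x2*x5 + (11/10)*x3*x3 + (-211/100)*x3*x4 + (27/100)*x3*x5 + (12/5)*x4*x4 + (-251/100)*x4*x5 + (153/100)*x5*x5 =
      40*(x1 + (-1/4)*x2 + (-11/80)*x3 + (131/800)*x4 + (-1/80)*x5)^2
      + 4*(x2 + (-3/32)*x3 + (533/1600)*x4 + (-209/400)*x5)^2
      + (79/256)*(x3 + (-377/3950)*x4 + (-166/395)*x5)^2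
      + (278313/316000)*(x4 + (-257683/463855)*x5)^2
      + (122250039/1159637500)*(x5)^2 := by ring
  rw [h]; positivity

lemma certB2 (x1 x2 x3 x4 x5 : ℝ) :
    0 ≤ 40*x1*x1 + (-20)*x1*x2 + (-11)*x1*x3 + (121/10)*x1*x4 + (-7/10)*x1*x5 + (61/10)*x2*x2 + (5/2)*x2*x3 + (-2/5)*x2*x4 + (-19/5)*x2*x5 + (11/10)*x3*x3 + (-23/10)*x3*x4 + (1/5)*x3*x5 + (12/5)*x4*x4 + (-5/2)*x4*x5 + (3/2)*x5*x5 := by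
  have h : 40*x1*x1 + (-20)*x1*x2 + (-11)*x1*x3 + (121/10)*x1*x4 + (-7/10)*x1*x5 + (61/10)*x2*x2 + (5/2)*x2*x3 + (-2/5)*x2*x4 + (-19/5)*x2*x5 + (11/10)*x3*x3 + (-23/10)*x3*x4 + (1/5)*x3*x5 + (12/5)*x4*x4 + (-5/2)*x4*x5 + (3/2)*x5*x5 =
      40*(x1 + (-1/4)*x2 + (-11/80)*x3 + (121/800)*x4 + (-7/800)*x5)^2
      + (18/5)*(x2 + (-5/144)*x3 + (35/96)*x4 + (-53/96)*x5)^2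
      + (391/1152)*(x3 + (-15699/19550)*x4 + (-987/19550)*x5)^2
      + (6158701/7820000)*(x4 + (-3802187/6158701)*x5)^2
      + (6074583/61587010)*(x5)^2 := by ring
  rw [h]; positivity

lemma gramQ_nonneg_A (α : ℝ) (h1 : 93/100 ≤ α) (h2 : α ≤ 9/5) (x1 x2 x3 x4 x5 : ℝ) :
    0 ≤ gramQ α ((563/500) + (-1149/500)*(α - 93/100) + (61/100)*(α - 93/100)^2) ((-1677/250) + (1563/250)*(α - 93/100) + (47/50)*(α - 93/100)^2) ((1137/500) + (-1987/500)*(α - 93/100) + (779/500)*(α - 93/100)^2) ((-547/125) + (3597/500)*(α - 93/100) + (-1401/500)*(α - 93/100)^2) ((489/100) + (-721/100)*(α - 93/100) + (101/50)*(α - 93/100)^2) ((-329/125) + (1949/500)*(α - 93/100) + (-557/500)*(α - 93/100)^2) ((213/500) + (-127/500)*(α - 93/100) + (-27/125)*(α - 93/100)^2) ((-6587/500) + (2049/100)*(α - 93/100) + (-3319/500)*(α - 93/100)^2) x1 x2 x3 x4 x5 := by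
  have hu : 0 ≤ ((α - 93/100)/(87/100)) := by apply div_nonneg <;> linarith
  have hv : 0 ≤ ((9/5 - α)/(87/100)) := by apply div_nonneg <;> linarith
  have q0 := certA0 x1 x2 x3 x4 x5
  have r0 := mul_nonneg (show 0 ≤ ((9/5 - α)/(87/100))^3 by positivity) q0
  have q1 := certA1 x1 x2 x3 x4 x5
  have r1 := mul_nonneg (show 0 ≤ 3*((9/5 - α)/(87/100))^2*((α - 93/100)/(87/100)) by positivity) q1
  have q2 := certA2 x1 x2 x3 x4 x5
  have r2 := mul_nonneg (show 0 ≤ 3*((9/5 - α)/(87/100))*((α - 93/100)/(87/100))^2 by positivity) q2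
  have q3 := certA3 x1 x2 x3 x4 x5
  have r3 := mul_nonneg (show 0 ≤ ((α - 93/100)/(87/100))^3 by positivity) q3
  have key := add_nonneg (add_nonneg r0 r1) (add_nonneg r2 r3)
  refine key.trans_eq ?_
  unfold gramQ
  ring

lemma gramQ_nonneg_B (α : ℝ) (h1 : 9/5 ≤ α) (h2 : α ≤ 2) (x1 x2 x3 x4 x5 : ℝ) :
    0 ≤ gramQ α (1*(2 - α)) ((-21/10)*(2 - α)) ((-13/10)*(2 - α)) ((-11/10)*(2 - α)) ((7/10)*(2 - α)) ((-1/10)*(2 - α)) ((3/10)*(2 - α)) ((-6/5)*(2 - α)) x1 x2 x3 x4 x5 := by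
  have hb : 0 ≤ 2 - α := by linarith
  have hu : 0 ≤ ((α - 9/5)*5) := by linarith
  have hv : 0 ≤ ((2 - α)*5) := by linarith
  have q0 := certB0 x1 x2 x3 x4 x5
  have r0 := mul_nonneg (mul_nonneg hb (show 0 ≤ ((2 - α)*5)^2 by positivity)) q0
  have q1 := certB1 x1 x2 x3 x4 x5
  have r1 := mul_nonneg (mul_nonneg hb (show 0 ≤ 2*((2 - α)*5)*((α - 9/5)*5) by positivity)) q1
  have q2 := certB2 x1 x2 x3 x4 x5
  have r2 := mul_nonneg (mul_nonneg hb (show 0 ≤ ((α - 9/5)*5)^2 by positivity)) q2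
  have r3 : 0 ≤ 40*(α - 9/5)*x1^2 := by
    have : 0 ≤ α - 9/5 := by linarith
    positivity
  have key := add_nonneg (add_nonneg r0 r1) (add_nonneg r2 r3)
  refine key.trans_eq ?_
  unfold gramQ
  ring

open MvPolynomial in
/-- The polynomial whose total derivative is used in the integration by parts. -/
noncomputable def certM (α y0 y1 y2 y3 y4 y5 y6 : ℝ) : MvPolynomial ℕ ℝ :=
  C ((-2)) * (X 6*X 1) + C (2) * (X 5*X 2) + C ((-2) + 1*α) * (X 5*X 1*X 1) + C ((-8)) * (X 4*X 3) + C (20 + (-10)*α) * (X 4*X 2*X 1) + C ((-6) + 5*α + (-1)*α^2) * (X 4*X 1*X 1*X 1) + C (12 + (-6)*α) * (X 3*X 3*X 1)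
  + C y0 * (C (1) * (X 3*X 2*X 2) + C ((-2)) * (X 3*X 3*X 1))
  + C y1 * (C (1) * (X 3*X 2*X 1*X 1))
  + C y2 * (C (1) * (X 3*X 1*X 1*X 1*X 1))
  + C y3 * (C (1) * (X 2*X 2*X 2*X 1))
  + C y4 * (C (1) * (X 2*X 2*X 1*X 1*X 1))
  + C y5 * (C (1) * (X 2*X 1*X 1*X 1*X 1*X 1))
  + C y6 * (C (1) * (X 1*X 1*X 1*X 1*X 1*X 1*X 1))

/-- `D k` models `∂_x` (for `k = 1`) and `2 ∂_t` (for `k = 2`) on polynomials in `p_i / p`. -/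
noncomputable def Dk (k : ℕ) : Derivation ℝ (MvPolynomial ℕ ℝ) (MvPolynomial ℕ ℝ) :=
  MvPolynomial.mkDerivation ℝ
    (fun i => MvPolynomial.X (i + k) - MvPolynomial.X k * MvPolynomial.X i)

/-- The operator induced by `Dk k` on the polynomial factor of `p ^ α * P`. -/
noncomputable def Tk (α : ℝ) (k : ℕ) (P : MvPolynomial ℕ ℝ) : MvPolynomial ℕ ℝ :=
  MvPolynomial.C α * MvPolynomial.X k * P + Dk k P

lemma Dk_X (k i : ℕ) : Dk k (MvPolynomial.X i) =
    MvPolynomial.X (i + k) - MvPolynomial.X k * MvPolynomial.X i := by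
  simp [Dk, MvPolynomial.mkDerivation_X]

lemma Dk_C (k : ℕ) (c : ℝ) : Dk k (MvPolynomial.C c) = 0 := by
  exact (Dk k).map_algebraMap c

lemma Dk_mul (k : ℕ) (P Q : MvPolynomial ℕ ℝ) : Dk k (P * Q) = P * Dk k Q + Q * Dk k P := by
  simp [Derivation.leibniz]

open MvPolynomial in
lemma T2_step1 (α : ℝ) : Tk α 2 (X 1 * X 1) = C (α - 2) * X 2 * X 1 * X 1 + 2 * X 3 * X 1 := by
  simp only [Tk, Dk_mul, Dk_X, C_sub, show (2 : ℝ) = (2 : ℕ) from by norm_num, map_natCast]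
  push_cast
  ring_nf

open MvPolynomial in
lemma cert_identity (α y0 y1 y2 y3 y4 y5 y6 y7 : ℝ) (a : ℕ → ℝ) :
    eval a (Tk α 2 (Tk α 2 (Tk α 2 (X 1 * X 1)))) + eval a (Tk α 1 (certM α y0 y1 y2 y3 y4 y5 y6))
      = - gramQ α y0 y1 y2 y3 y4 y5 y6 y7 (a 4) (a 3 * a 1) (a 2 * a 2) (a 2 * a 1 * a 1)
          (a 1 * a 1 * a 1 * a 1) := by
  rw [T2_step1]
  have e2 : (2 : MvPolynomial ℕ ℝ) = C 2 := (map_ofNat C 2).symm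
  rw [e2]
  simp only [certM, Tk, map_add, map_sub, map_mul, Dk_mul, Dk_X, Dk_C, eval_X, eval_C, map_zero, mul_zero, add_zero, Nat.reduceAdd]
  unfold gramQ
  ring

open MvPolynomial in
lemma cert_exists_aux (α y0 y1 y2 y3 y4 y5 y6 y7 : ℝ)
    (h : ∀ x1 x2 x3 x4 x5 : ℝ, 0 ≤ gramQ α y0 y1 y2 y3 y4 y5 y6 y7 x1 x2 x3 x4 x5) :
    ∃ M : MvPolynomial ℕ ℝ, ∀ a : ℕ → ℝ,
      eval a (Tk α 2 (Tk α 2 (Tk α 2 (X 1 * X 1)))) + eval a (Tk α 1 M) ≤ 0 := by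
  refine ⟨certM α y0 y1 y2 y3 y4 y5 y6, fun a => ?_⟩
  rw [cert_identity α y0 y1 y2 y3 y4 y5 y6 y7 a, neg_nonpos]
  exact h _ _ _ _ _

open MvPolynomial in
lemma cert_exists (α : ℝ) (h1 : 0.93 ≤ α) (h2 : α ≤ 2) :
    ∃ M : MvPolynomial ℕ ℝ, ∀ a : ℕ → ℝ,
      eval a (Tk α 2 (Tk α 2 (Tk α 2 (X 1 * X 1)))) + eval a (Tk α 1 M) ≤ 0 := by
  norm_num at h1
  by_cases h : α ≤ 9/5
  · exact cert_exists_aux α _ _ _ _ _ _ _ _ (gramQ_nonneg_A α h1 h)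
  · exact cert_exists_aux α _ _ _ _ _ _ _ _ (gramQ_nonneg_B α (not_le.mp h).le h2)

/-- Derivatives of the Gaussian kernel, by the Hermite recursion. -/
noncomputable def gk : ℕ → ℝ → ℝ → ℝ
  | 0, t, u => (Real.sqrt (2 * Real.pi * t))⁻¹ * Real.exp (-u ^ 2 / (2 * t))
  | 1, t, u => -t⁻¹ * u * ((Real.sqrt (2 * Real.pi * t))⁻¹ * Real.exp (-u ^ 2 / (2 * t)))
  | (k + 2), t, u => -t⁻¹ * (u * gk (k + 1) t u + (k + 1) * gk k t u)

lemma gk_zero (t u : ℝ) :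
    gk 0 t u = (Real.sqrt (2 * Real.pi * t))⁻¹ * Real.exp (-u ^ 2 / (2 * t)) := by
  simp [gk]

lemma gk_one (t u : ℝ) : gk 1 t u = -t⁻¹ * u * gk 0 t u := by
  simp [gk]

lemma gk_succ_succ (k : ℕ) (t u : ℝ) :
    gk (k + 2) t u = -t⁻¹ * (u * gk (k + 1) t u + (k + 1) * gk k t u) := by
  rw [gk]

lemma gk_zero_pos {t : ℝ} (ht : 0 < t) (u : ℝ) : 0 < gk 0 t u := by
  rw [gk_zero]; positivity

lemma gk_hasDerivAt_u {t : ℝ} (ht : 0 < t) (k : ℕ) :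
    ∀ u, HasDerivAt (fun u => gk k t u) (gk (k + 1) t u) u := by
  induction k using Nat.strong_induction_on with
  | _ k ih =>
    match k, ih with
    | 0, _ =>
      intro u
      have h1 : HasDerivAt (fun u : ℝ => -u ^ 2 / (2 * t)) (-t⁻¹ * u) u := by
        have := ((hasDerivAt_id u).pow 2).neg.div_const (2 * t)
        refine this.congr_deriv ?_
        simp; field_simp
      have h2 := (h1.exp).const_mul ((Real.sqrt (2 * Real.pi * t))⁻¹)
      simp only [gk_zero, gk_one, zero_add]
      refine h2.congr_deriv ?_
      ring
    | 1, ih =>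
      intro u
      have h0 := ih 0 (by norm_num) u
      have h2 := ((hasDerivAt_id u).const_mul (-t⁻¹)).mul h0
      have e : (fun u => gk 1 t u) = ((fun y => -t⁻¹ * id y) * fun u => gk 0 t u) := by
        funext v; simp [gk_one]
      rw [e]
      refine h2.congr_deriv ?_
      simp only [gk_succ_succ, id]
      push_cast
      ring
    | (k + 2), ih =>
      intro u
      have h0 := ih k (by omega) u
      have h1 := ih (k + 1) (by omega) u
      have h2 := (((hasDerivAt_id u).mul h1).add (h0.const_mul ((k : ℝ) + 1))).const_mul (-t⁻¹)
      have e : (fun u => gk (k + 2) t u) =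
          fun u => -t⁻¹ * (((id * fun u => gk (k + 1) t u) + fun u => ((k : ℝ) + 1) * gk k t u : ℝ → ℝ) u) := by
        funext v; simp [gk_succ_succ]
      rw [e]
      refine h2.congr_deriv ?_
      rw [gk_succ_succ (k + 1)]
      simp only [id]
      push_cast
      ring

lemma gk_hasDerivAt_t {t : ℝ} (ht : 0 < t) (u : ℝ) (k : ℕ) :
    HasDerivAt (fun t => gk k t u) (gk (k + 2) t u / 2) t := by
  have hinv : HasDerivAt (fun t : ℝ => -t⁻¹) (t⁻¹ ^ 2) t := by
    have := (hasDerivAt_inv ht.ne').neg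
    refine this.congr_deriv ?_
    simp
  induction k using Nat.strong_induction_on with
  | _ k ih =>
    match k, ih with
    | 0, _ =>
      have hs : HasDerivAt (fun t : ℝ => Real.sqrt (2 * Real.pi * t))
          (2 * Real.pi / (2 * Real.sqrt (2 * Real.pi * t))) t := by
        have := ((hasDerivAt_id t).const_mul (2 * Real.pi)).sqrt (by simp; positivity)
        simpa using this
      have hs' := hs.inv (by positivity)
      have h1 : HasDerivAt (fun t : ℝ => -u ^ 2 / (2 * t)) (u ^ 2 * t⁻¹ ^ 2 / 2) t := by
        have := hinv.const_mul (u ^ 2 / 2)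
        have e0 : (fun t : ℝ => -u ^ 2 / (2 * t)) = fun t => u ^ 2 / 2 * -t⁻¹ := by
          funext v; by_cases hv : v = 0
          · simp [hv]
          · field_simp
        rw [e0]
        exact this.congr_deriv (by ring)
      have h2 := hs'.mul h1.exp
      have e : (fun t => gk 0 t u) = ((fun t : ℝ => (Real.sqrt (2 * Real.pi * t)))⁻¹ *
          fun t => Real.exp (-u ^ 2 / (2 * t))) := by
        funext v; simp [gk_zero]
      rw [e]
      refine h2.congr_deriv ?_
      have hpos : 0 < Real.sqrt (2 * Real.pi * t) := by positivity
      have hsq : Real.sqrt (2 * Real.pi * t) ^ 2 = 2 * Real.pi * t :=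
        Real.sq_sqrt (by positivity)
      rw [gk_succ_succ, zero_add, gk_one, gk_zero]
      simp only [Pi.inv_apply]
      set S := Real.sqrt (2 * Real.pi * t)
      set E := Real.exp (-u ^ 2 / (2 * t))
      have h3 : 2 * Real.pi = S ^ 2 * t⁻¹ := by rw [hsq]; field_simp
      rw [h3]
      field_simp
      push_cast
      ring
    | 1, ih =>
      have h0 := ih 0 (by norm_num)
      have h2 := (hinv.mul_const u).mul h0
      have e : (fun t => gk 1 t u) = ((fun t : ℝ => -t⁻¹ * u) * fun t => gk 0 t u) := by
        funext v; simp [gk_one]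
      rw [e]
      refine h2.congr_deriv ?_
      rw [gk_succ_succ 1, gk_one]
      push_cast
      ring
    | (k + 2), ih =>
      have h0 := ih k (by omega)
      have h1 := ih (k + 1) (by omega)
      have h2 := hinv.mul ((h1.const_mul u).add (h0.const_mul ((k : ℝ) + 1)))
      have e : (fun t => gk (k + 2) t u) = ((fun t : ℝ => -t⁻¹) *
          ((fun t => u * gk (k + 1) t u) + fun t => ((k : ℝ) + 1) * gk k t u)) := by
        funext v; simp [gk_succ_succ]
      rw [e]
      refine h2.congr_deriv ?_
      simp only [Pi.add_apply]
      rw [gk_succ_succ (k + 2)]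
      rw [show k + 1 + 2 = k + 2 + 1 by ring]
      have e3 : t⁻¹ * gk (k + 2) t u =
        - (t⁻¹ ^ 2 * (u * gk (k + 1) t u + (k + 1) * gk k t u)) := by
          rw [gk_succ_succ k]; ring
      push_cast
      linear_combination e3

lemma gk_bound1 {t1 : ℝ} (ht1 : 0 < t1) (k : ℕ) :
    ∃ C : ℝ, 0 ≤ C ∧ ∀ t, t1 ≤ t → ∀ u, |gk k t u| ≤ C * (1 + |u|) ^ k * gk 0 t u := by
  induction k using Nat.strong_induction_on with
  | _ k ih =>
    match k, ih with
    | 0, _ =>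
      exact ⟨1, zero_le_one, fun t ht u => by
        rw [abs_of_pos (gk_zero_pos (ht1.trans_le ht) u)]; simp⟩
    | 1, _ =>
      refine ⟨t1⁻¹, by positivity, fun t ht u => ?_⟩
      have hp := gk_zero_pos (ht1.trans_le ht) u
      have hi : t⁻¹ ≤ t1⁻¹ := inv_anti₀ ht1 ht
      have hi0 : 0 < t⁻¹ := inv_pos.mpr (ht1.trans_le ht)
      rw [gk_one, abs_mul, abs_mul, abs_neg, abs_of_pos hi0, abs_of_pos hp, pow_one]
      have : |u| ≤ 1 + |u| := by linarith
      gcongr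
    | (k + 2), ih =>
      obtain ⟨C0, hC0, h0⟩ := ih k (by omega)
      obtain ⟨C1, hC1, h1⟩ := ih (k + 1) (by omega)
      refine ⟨t1⁻¹ * (C1 + (k + 1) * C0), by positivity, fun t ht u => ?_⟩
      have hp := gk_zero_pos (ht1.trans_le ht) u
      have hi : t⁻¹ ≤ t1⁻¹ := inv_anti₀ ht1 ht
      have hi0 : 0 < t⁻¹ := inv_pos.mpr (ht1.trans_le ht)
      rw [gk_succ_succ, abs_mul, abs_neg, abs_of_pos hi0]
      have a0 : 0 ≤ |u| := abs_nonneg u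
      have hu : |u| ≤ 1 + |u| := by linarith
      have h1u : 1 ≤ 1 + |u| := by linarith
      have b1 : |u * gk (k + 1) t u| ≤ C1 * (1 + |u|) ^ (k + 2) * gk 0 t u := by
        rw [abs_mul]
        calc |u| * |gk (k + 1) t u| ≤ (1 + |u|) * (C1 * (1 + |u|) ^ (k + 1) * gk 0 t u) := by
              gcongr; exact h1 t ht u
          _ = _ := by ring
      have b0 : |((k : ℝ) + 1) * gk k t u| ≤ (k + 1) * C0 * (1 + |u|) ^ (k + 2) * gk 0 t u := by
        rw [abs_mul, abs_of_pos (by positivity : (0 : ℝ) < (k : ℝ) + 1)]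
        calc ((k : ℝ) + 1) * |gk k t u| ≤ (k + 1) * (C0 * (1 + |u|) ^ (k + 2) * gk 0 t u) := by
              gcongr
              refine (h0 t ht u).trans ?_
              gcongr
              omega
          _ = _ := by ring
      calc t⁻¹ * |u * gk (k + 1) t u + (k + 1) * gk k t u|
          ≤ t1⁻¹ * (C1 * (1 + |u|) ^ (k + 2) * gk 0 t u +
            (k + 1) * C0 * (1 + |u|) ^ (k + 2) * gk 0 t u) := by
            gcongr
            exact (abs_add_le _ _).trans (add_le_add b1 b0)
        _ = _ := by ring

lemma gk_bound2 {t1 t2 s : ℝ} (ht1 : 0 < t1) (h2s : t2 < s) (n : ℕ) :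
    ∃ C : ℝ, 0 < C ∧ ∀ t, t1 ≤ t → t ≤ t2 → ∀ u, (1 + |u|) ^ n * gk 0 t u ≤ C * gk 0 s u := by
  by_cases h12 : t1 ≤ t2
  swap
  · exact ⟨1, one_pos, fun t h h' => absurd (h.trans h') h12⟩
  have ht2 : 0 < t2 := ht1.trans_le h12
  have hs : 0 < s := ht2.trans h2s
  obtain ⟨c, hc⟩ : ∃ c, c = (t2⁻¹ - s⁻¹) / 2 := ⟨_, rfl⟩
  have hc0 : 0 < c := by
    have : s⁻¹ < t2⁻¹ := inv_strictAnti₀ ht2 h2s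
    linarith
  refine ⟨n.factorial * Real.exp (1 + 1 / (4 * c)) * (Real.sqrt (2 * Real.pi * t1))⁻¹ *
    Real.sqrt (2 * Real.pi * s), by positivity, fun t h1 h2 u => ?_⟩
  have ht : 0 < t := ht1.trans_le h1
  have e1 : (1 + |u|) ^ n ≤ n.factorial * Real.exp (1 + |u|) := by
    have := Real.pow_div_factorial_le_exp (1 + |u|) (by positivity) n
    rw [div_le_iff₀ (by positivity)] at this
    linarith
  have e2 : (Real.sqrt (2 * Real.pi * t))⁻¹ ≤ (Real.sqrt (2 * Real.pi * t1))⁻¹ := by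
    apply inv_anti₀ (by positivity)
    apply Real.sqrt_le_sqrt
    gcongr
  have e3 : Real.exp (1 + |u|) * Real.exp (-u ^ 2 / (2 * t)) ≤
      Real.exp (1 + 1 / (4 * c)) * Real.exp (-u ^ 2 / (2 * s)) := by
    rw [← Real.exp_add, ← Real.exp_add, Real.exp_le_exp]
    have hi : t2⁻¹ ≤ t⁻¹ := inv_anti₀ ht h2
    have i1 : -u ^ 2 / (2 * t) = - (u ^ 2) * t⁻¹ / 2 := by field_simp
    have i2 : -u ^ 2 / (2 * s) = - (u ^ 2) * s⁻¹ / 2 := by field_simp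
    rw [i1, i2]
    have i3 : u ^ 2 * t2⁻¹ ≤ u ^ 2 * t⁻¹ := by gcongr
    have i4 : |u| ≤ 1 / (4 * c) + c * u ^ 2 := by
      have : 0 ≤ c * (|u| - 1 / (2 * c)) ^ 2 := by positivity
      have i5 : c * (|u| - 1 / (2 * c)) ^ 2 = c * |u| ^ 2 - |u| + 1 / (4 * c) := by
        field_simp; ring
      rw [i5, sq_abs] at this
      linarith
    rw [hc] at i4 ⊢
    nlinarith
  rw [gk_zero, gk_zero]
  calc (1 + |u|) ^ n * ((Real.sqrt (2 * Real.pi * t))⁻¹ * Real.exp (-u ^ 2 / (2 * t)))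
      ≤ (n.factorial * Real.exp (1 + |u|)) *
        ((Real.sqrt (2 * Real.pi * t1))⁻¹ * Real.exp (-u ^ 2 / (2 * t))) := by gcongr
    _ = n.factorial * (Real.sqrt (2 * Real.pi * t1))⁻¹ *
        (Real.exp (1 + |u|) * Real.exp (-u ^ 2 / (2 * t))) := by ring
    _ ≤ n.factorial * (Real.sqrt (2 * Real.pi * t1))⁻¹ *
        (Real.exp (1 + 1 / (4 * c)) * Real.exp (-u ^ 2 / (2 * s))) := by gcongr
    _ = _ := by
      have : Real.sqrt (2 * Real.pi * s) ≠ 0 := by positivity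
      field_simp

lemma gk_bound3 {t1 t2 s : ℝ} (ht1 : 0 < t1) (h2s : t2 < s) (k : ℕ) {δ : ℝ} (hδ : 0 < δ) :
    ∃ C : ℝ, 0 ≤ C ∧ ∀ t, t1 ≤ t → t ≤ t2 → ∀ u,
      |gk k t u| ≤ C * ((gk 0 t u) ^ (1 - δ) * (gk 0 s u) ^ δ) := by
  by_cases h12 : t1 ≤ t2
  swap
  · exact ⟨1, zero_le_one, fun t h h' => absurd (h.trans h') h12⟩
  have hs : 0 < s := (ht1.trans_le h12).trans h2s
  obtain ⟨C1, hC1, hb1⟩ := gk_bound1 ht1 k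
  obtain ⟨n, hn⟩ := exists_nat_ge ((k : ℝ) / δ)
  obtain ⟨C2, hC2, hb2⟩ := gk_bound2 ht1 h2s n
  refine ⟨C1 * C2 ^ δ, by positivity, fun t h1 h2 u => ?_⟩
  have hK := gk_zero_pos (ht1.trans_le h1) u
  have hS := gk_zero_pos hs u
  have h1u : 1 ≤ 1 + |u| := by linarith [abs_nonneg u]
  have e1 : (1 + |u|) ^ k ≤ ((1 + |u|) ^ n) ^ δ := by
    rw [← Real.rpow_natCast, ← Real.rpow_natCast, ← Real.rpow_mul (by positivity)]
    apply Real.rpow_le_rpow_of_exponent_le h1u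
    rwa [div_le_iff₀ hδ] at hn
  calc |gk k t u| ≤ C1 * (1 + |u|) ^ k * gk 0 t u := hb1 t h1 u
    _ = C1 * ((1 + |u|) ^ k * ((gk 0 t u) ^ (1 - δ) * (gk 0 t u) ^ δ)) := by
      rw [← Real.rpow_add hK]; simp; ring
    _ ≤ C1 * (((1 + |u|) ^ n) ^ δ * ((gk 0 t u) ^ (1 - δ) * (gk 0 t u) ^ δ)) := by gcongr
    _ = C1 * ((gk 0 t u) ^ (1 - δ) * ((1 + |u|) ^ n * gk 0 t u) ^ δ) := by
      rw [Real.mul_rpow (by positivity) hK.le]; ring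
    _ ≤ C1 * ((gk 0 t u) ^ (1 - δ) * (C2 * gk 0 s u) ^ δ) := by
      have := hb2 t h1 h2 u
      have h3 : ((1 + |u|) ^ n * gk 0 t u) ^ δ ≤ (C2 * gk 0 s u) ^ δ :=
        Real.rpow_le_rpow (by positivity) this hδ.le
      exact mul_le_mul_of_nonneg_left (mul_le_mul_of_nonneg_left h3 (by positivity)) hC1
    _ = _ := by rw [Real.mul_rpow hC2.le hS.le]; ring

lemma gk_bound4 {t1 t2 : ℝ} (ht1 : 0 < t1) (k : ℕ) :
    ∃ C : ℝ, 0 ≤ C ∧ ∀ t, t1 ≤ t → t ≤ t2 → ∀ u, |gk k t u| ≤ C := by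
  by_cases h12 : t1 ≤ t2
  swap
  · exact ⟨1, zero_le_one, fun t h h' => absurd (h.trans h') h12⟩
  have hs : 0 < t2 + 1 := by linarith
  obtain ⟨C, hC, h⟩ := gk_bound3 ht1 (lt_add_one t2) k one_pos
  refine ⟨C * (Real.sqrt (2 * Real.pi * (t2 + 1)))⁻¹, by positivity, fun t h1 h2 u => ?_⟩
  refine (h t h1 h2 u).trans ?_
  simp only [sub_self, Real.rpow_zero, one_mul, Real.rpow_one]
  gcongr
  rw [gk_zero]
  apply mul_le_of_le_one_right (by positivity)
  rw [Real.exp_le_one_iff]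
  apply div_nonpos_of_nonpos_of_nonneg
  · nlinarith [sq_nonneg u]
  · positivity

/-- The `k`-th spatial derivative of the heat flow, as an integral. -/
noncomputable def hp (f : ℝ → ℝ) (k : ℕ) (t x : ℝ) : ℝ := ∫ y : ℝ, f y * gk k t (x - y)

lemma gk_continuous {t : ℝ} (ht : 0 < t) (k : ℕ) : Continuous (fun u => gk k t u) :=
  continuous_iff_continuousAt.mpr fun u => (gk_hasDerivAt_u ht k u).continuousAt

lemma hp_integrable {f : ℝ → ℝ} (hi : Integrable f) {t : ℝ} (ht : 0 < t) (k : ℕ) (x : ℝ) :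
    Integrable (fun y => f y * gk k t (x - y)) := by
  obtain ⟨C, hC, h⟩ := gk_bound4 (t2 := t) ht k
  have hc : Continuous (fun y => gk k t (x - y)) :=
    (gk_continuous ht k).comp (continuous_const.sub continuous_id)
  exact hi.mul_bdd hc.aestronglyMeasurable
    (Eventually.of_forall fun y => h t le_rfl le_rfl (x - y))

lemma hp_hasDerivAt_x {f : ℝ → ℝ} (hi : Integrable f) {t : ℝ} (ht : 0 < t) (k : ℕ) (x : ℝ) :
    HasDerivAt (fun x => hp f k t x) (hp f (k + 1) t x) x := by
  obtain ⟨C, hC, h⟩ := gk_bound4 (t2 := t) ht (k + 1)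
  refine (hasDerivAt_integral_of_dominated_loc_of_deriv_le (bound := fun y => |f y| * C)
    (s := Set.univ) Filter.univ_mem
    (Eventually.of_forall fun x => (hp_integrable hi ht k x).aestronglyMeasurable)
    (hp_integrable hi ht k x) (F' := fun x y => f y * gk (k + 1) t (x - y))
    (hp_integrable hi ht (k + 1) x).aestronglyMeasurable ?_ (hi.abs.mul_const C) ?_).2
  · refine Eventually.of_forall fun y x _ => ?_
    rw [norm_mul, Real.norm_eq_abs, Real.norm_eq_abs]
    have := h t le_rfl le_rfl (x - y)
    gcongr
  · refine Eventually.of_forall fun y x _ => ?_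
    have h1 := (gk_hasDerivAt_u ht k (x - y)).comp x ((hasDerivAt_id x).sub_const y)
    exact (h1.const_mul (f y)).congr_deriv (by simp)

lemma hp_hasDerivAt_t {f : ℝ → ℝ} (hi : Integrable f) {t : ℝ} (ht : 0 < t) (k : ℕ) (x : ℝ) :
    HasDerivAt (fun t => hp f k t x) (hp f (k + 2) t x / 2) t := by
  obtain ⟨C, hC, h⟩ := gk_bound4 (t1 := t / 2) (t2 := 2 * t) (by positivity) (k + 2)
  have hmem : Set.Ioo (t / 2) (2 * t) ∈ nhds t := Ioo_mem_nhds (by linarith) (by linarith)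
  have key := (hasDerivAt_integral_of_dominated_loc_of_deriv_le (μ := volume)
    (bound := fun y => |f y| * C)
    (F := fun t y => f y * gk k t (x - y))
    (s := Set.Ioo (t / 2) (2 * t)) hmem
    (by filter_upwards [hmem] with r hr
        exact (hp_integrable hi (by linarith [hr.1]) k x).aestronglyMeasurable)
    (hp_integrable hi ht k x) (F' := fun t y => f y * (gk (k + 2) t (x - y) / 2))
    ?_ ?_ (hi.abs.mul_const C) ?_).2
  · refine key.congr_deriv ?_
    rw [hp, ← integral_div]
    congr 1; funext y; ring
  · have := ((hp_integrable hi ht (k + 2) x).div_const 2).aestronglyMeasurable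
    refine this.congr (Eventually.of_forall fun y => ?_)
    simp only; ring
  · refine Eventually.of_forall fun y r hr => ?_
    rw [norm_mul, Real.norm_eq_abs, Real.norm_eq_abs, abs_div, abs_two]
    have := h r hr.1.le hr.2.le (x - y)
    have h0 := abs_nonneg (gk (k + 2) r (x - y))
    gcongr
    linarith
  · refine Eventually.of_forall fun y r hr => ?_
    exact (gk_hasDerivAt_t (by linarith [hr.1]) (x - y) k).const_mul (f y)

lemma hp_pos {f : ℝ → ℝ} (hi : Integrable f) (hf0 : ∀ x, 0 ≤ f x) (hf1 : (∫ x : ℝ, f x) = 1)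
    {t : ℝ} (ht : 0 < t) (x : ℝ) : 0 < hp f 0 t x := by
  have h1 : 0 < volume (Function.support f) := by
    rw [← integral_pos_iff_support_of_nonneg hf0 hi, hf1]; exact one_pos
  unfold hp
  rw [integral_pos_iff_support_of_nonneg
    (fun y => mul_nonneg (hf0 y) (gk_zero_pos ht _).le) (hp_integrable hi ht 0 x)]
  convert h1 using 2
  ext y
  simp [(gk_zero_pos ht (x - y)).ne']

lemma hp_bound {f : ℝ → ℝ} (hi : Integrable f) (hf0 : ∀ x, 0 ≤ f x) (hf1 : (∫ x : ℝ, f x) = 1)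
    {t1 t2 s : ℝ} (ht1 : 0 < t1) (h2s : t2 < s) (k : ℕ) {δ : ℝ} (hδ : 0 < δ) (hδ1 : δ ≤ 1) :
    ∃ C : ℝ, 0 ≤ C ∧ ∀ t, t1 ≤ t → t ≤ t2 → ∀ x,
      |hp f k t x| ≤ C * ((hp f 0 t x) ^ (1 - δ) * (hp f 0 s x) ^ δ) := by
  by_cases h12 : t1 ≤ t2
  swap
  · exact ⟨1, zero_le_one, fun t h h' => absurd (h.trans h') h12⟩
  have hs : 0 < s := (ht1.trans_le h12).trans h2s
  obtain ⟨C, hC, h⟩ := gk_bound3 ht1 h2s k hδ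
  refine ⟨C, hC, fun t h1 h2 x => ?_⟩
  have ht : 0 < t := ht1.trans_le h1
  have hP := hp_pos hi hf0 hf1 ht x
  have hR := hp_pos hi hf0 hf1 hs x
  set P := hp f 0 t x with hPdef
  set R := hp f 0 s x with hRdef
  have hB : Integrable (fun y => C * (P ^ (1 - δ) * R ^ δ) *
      ((1 - δ) / P * (f y * gk 0 t (x - y)) + δ / R * (f y * gk 0 s (x - y)))) :=
    (((hp_integrable hi ht 0 x).const_mul _).add ((hp_integrable hi hs 0 x).const_mul _)).const_mul _
  have hval : (∫ y, C * (P ^ (1 - δ) * R ^ δ) *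
      ((1 - δ) / P * (f y * gk 0 t (x - y)) + δ / R * (f y * gk 0 s (x - y))))
      = C * (P ^ (1 - δ) * R ^ δ) := by
    rw [integral_const_mul, integral_add ((hp_integrable hi ht 0 x).const_mul _)
      ((hp_integrable hi hs 0 x).const_mul _), integral_const_mul, integral_const_mul]
    change _ * ((1 - δ) / P * P + δ / R * R) = _
    field_simp
    ring
  rw [← hval]
  have hb : ∀ y, ‖f y * gk k t (x - y)‖ ≤ C * (P ^ (1 - δ) * R ^ δ) *
      ((1 - δ) / P * (f y * gk 0 t (x - y)) + δ / R * (f y * gk 0 s (x - y))) := by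
    intro y
    have hK := gk_zero_pos ht (x - y)
    have hS := gk_zero_pos hs (x - y)
    have g := Real.geom_mean_le_arith_mean2_weighted (w₁ := 1 - δ) (w₂ := δ)
      (p₁ := gk 0 t (x - y) / P) (p₂ := gk 0 s (x - y) / R) (by linarith) hδ.le
      (by positivity) (by positivity) (by ring)
    rw [Real.div_rpow hK.le hP.le, Real.div_rpow hS.le hR.le] at g
    have hPp : 0 < P ^ (1 - δ) := by positivity
    have hRp : 0 < R ^ δ := by positivity
    have g2 : gk 0 t (x - y) ^ (1 - δ) * gk 0 s (x - y) ^ δ ≤ (P ^ (1 - δ) * R ^ δ) *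
        ((1 - δ) * (gk 0 t (x - y) / P) + δ * (gk 0 s (x - y) / R)) := by
      refine le_trans (le_of_eq ?_) (mul_le_mul_of_nonneg_left g (by positivity))
      field_simp
    rw [norm_mul, Real.norm_eq_abs, Real.norm_eq_abs, abs_of_nonneg (hf0 y)]
    calc f y * |gk k t (x - y)| ≤ f y * (C * ((P ^ (1 - δ) * R ^ δ) *
        ((1 - δ) * (gk 0 t (x - y) / P) + δ * (gk 0 s (x - y) / R)))) := by
          refine mul_le_mul_of_nonneg_left ((h t h1 h2 (x - y)).trans ?_) (hf0 y)
          exact mul_le_mul_of_nonneg_left g2 hC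
      _ = _ := by ring
  have := norm_integral_le_of_norm_le hB (Eventually.of_forall hb)
  rwa [Real.norm_eq_abs] at this

lemma hp_comp {f : ℝ → ℝ} (hi : Integrable f) (hf0 : ∀ x, 0 ≤ f x)
    {t1 t2 s : ℝ} (ht1 : 0 < t1) (h2s : t2 < s) :
    ∃ C : ℝ, 0 < C ∧ ∀ t, t1 ≤ t → t ≤ t2 → ∀ x, hp f 0 t x ≤ C * hp f 0 s x := by
  obtain ⟨C, hC, h⟩ := gk_bound2 ht1 h2s 0
  refine ⟨C, hC, fun t h1 h2 x => ?_⟩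
  have ht : 0 < t := ht1.trans_le h1
  unfold hp
  rw [← integral_const_mul]
  refine integral_mono (hp_integrable hi ht 0 x)
    ((hp_integrable hi ((ht.trans_le h2).trans h2s) 0 x).const_mul C) fun y => ?_
  have := h t h1 h2 (x - y)
  simp only [pow_zero, one_mul] at this
  have h3 := mul_le_mul_of_nonneg_left this (hf0 y)
  simp only
  linarith

lemma hp_integrable_x {f : ℝ → ℝ} (hi : Integrable f) {t : ℝ} (ht : 0 < t) :
    Integrable (fun x => hp f 0 t x) := by
  have hg : Integrable (fun u => gk 0 t u) := by
    have := (integrable_exp_neg_mul_sq (b := 1 / (2 * t)) (by positivity)).const_mul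
      ((Real.sqrt (2 * Real.pi * t))⁻¹)
    refine this.congr (Eventually.of_forall fun u => ?_)
    simp only [gk_zero]
    congr 2; ring
  exact hi.integrable_convolution (ContinuousLinearMap.mul ℝ ℝ) hg

/-- `hr f t x i = p_i / p`. -/
noncomputable def hr (f : ℝ → ℝ) (t x : ℝ) (i : ℕ) : ℝ := hp f i t x / hp f 0 t x

/-- The integrand `p ^ α * P (p_1 / p, p_2 / p, …)`. -/
noncomputable def gP (f : ℝ → ℝ) (α : ℝ) (P : MvPolynomial ℕ ℝ) (t x : ℝ) : ℝ :=
  hp f 0 t x ^ α * MvPolynomial.eval (hr f t x) P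

lemma hr_hasDerivAt_x {f : ℝ → ℝ} (hi : Integrable f) (hf0 : ∀ x, 0 ≤ f x)
    (hf1 : (∫ x : ℝ, f x) = 1) {t : ℝ} (ht : 0 < t) (i : ℕ) (x : ℝ) :
    HasDerivAt (fun x => hr f t x i) (1 * (hr f t x (i + 1) - hr f t x 1 * hr f t x i)) x := by
  have hP := (hp_pos hi hf0 hf1 ht x).ne'
  refine ((hp_hasDerivAt_x hi ht i x).div (hp_hasDerivAt_x hi ht 0 x) hP).congr_deriv ?_
  simp only [hr, zero_add]
  field_simp

lemma hr_hasDerivAt_t {f : ℝ → ℝ} (hi : Integrable f) (hf0 : ∀ x, 0 ≤ f x)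
    (hf1 : (∫ x : ℝ, f x) = 1) {t : ℝ} (ht : 0 < t) (i : ℕ) (x : ℝ) :
    HasDerivAt (fun t => hr f t x i)
      ((1 / 2) * (hr f t x (i + 2) - hr f t x 2 * hr f t x i)) t := by
  have hP := (hp_pos hi hf0 hf1 ht x).ne'
  refine ((hp_hasDerivAt_t hi ht i x).div (hp_hasDerivAt_t hi ht 0 x) hP).congr_deriv ?_
  simp only [hr, zero_add]
  field_simp

lemma eval_hasDerivAt (a : ℝ → ℕ → ℝ) (z c : ℝ) (k : ℕ)
    (h : ∀ i, HasDerivAt (fun z => a z i) (c * (a z (i + k) - a z k * a z i)) z)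
    (P : MvPolynomial ℕ ℝ) :
    HasDerivAt (fun z => MvPolynomial.eval (a z) P) (c * MvPolynomial.eval (a z) (Dk k P)) z := by
  induction P using MvPolynomial.induction_on with
  | C r =>
    simp only [MvPolynomial.eval_C, Dk_C, map_zero, mul_zero]
    exact hasDerivAt_const _ _
  | add P Q hP hQ =>
    simp only [map_add]
    exact (hP.add hQ).congr_deriv (by ring)
  | mul_X P i hP =>
    simp only [map_mul, MvPolynomial.eval_X]
    refine (hP.mul (h i)).congr_deriv ?_
    simp only [Dk_mul, Dk_X, map_add, map_sub, map_mul, MvPolynomial.eval_X]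
    ring

lemma gP_hasDerivAt_x {f : ℝ → ℝ} (hi : Integrable f) (hf0 : ∀ x, 0 ≤ f x)
    (hf1 : (∫ x : ℝ, f x) = 1) (α : ℝ) (P : MvPolynomial ℕ ℝ) {t : ℝ} (ht : 0 < t) (x : ℝ) :
    HasDerivAt (fun x => gP f α P t x) (gP f α (Tk α 1 P) t x) x := by
  have hP := hp_pos hi hf0 hf1 ht x
  have h1 := (hp_hasDerivAt_x hi ht 0 x).rpow_const (p := α) (Or.inl hP.ne')
  have h2 := eval_hasDerivAt (fun x => hr f t x) x 1 1
    (fun i => hr_hasDerivAt_x hi hf0 hf1 ht i x) P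
  refine (h1.mul h2).congr_deriv ?_
  simp only [gP, Tk, map_add, map_mul, MvPolynomial.eval_X, MvPolynomial.eval_C, hr, zero_add]
  rw [Real.rpow_sub_one hP.ne']
  field_simp

lemma gP_hasDerivAt_t {f : ℝ → ℝ} (hi : Integrable f) (hf0 : ∀ x, 0 ≤ f x)
    (hf1 : (∫ x : ℝ, f x) = 1) (α : ℝ) (P : MvPolynomial ℕ ℝ) {t : ℝ} (ht : 0 < t) (x : ℝ) :
    HasDerivAt (fun t => gP f α P t x) (gP f α (Tk α 2 P) t x / 2) t := by
  have hP := hp_pos hi hf0 hf1 ht x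
  have h1 := (hp_hasDerivAt_t hi ht 0 x).rpow_const (p := α) (Or.inl hP.ne')
  have h2 := eval_hasDerivAt (fun t => hr f t x) t (1 / 2) 2
    (fun i => hr_hasDerivAt_t hi hf0 hf1 ht i x) P
  refine (h1.mul h2).congr_deriv ?_
  simp only [gP, Tk, map_add, map_mul, MvPolynomial.eval_X, MvPolynomial.eval_C, hr, zero_add]
  rw [Real.rpow_sub_one hP.ne']
  field_simp

lemma gP_continuous {f : ℝ → ℝ} (hi : Integrable f) (hf0 : ∀ x, 0 ≤ f x)
    (hf1 : (∫ x : ℝ, f x) = 1) (α : ℝ) (P : MvPolynomial ℕ ℝ) {t : ℝ} (ht : 0 < t) :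
    Continuous (fun x => gP f α P t x) :=
  continuous_iff_continuousAt.mpr fun x => (gP_hasDerivAt_x hi hf0 hf1 α P ht x).continuousAt

/-- Sub-polynomial growth of polynomials in `p_i / p`. -/
lemma eval_bound {f : ℝ → ℝ} (hi : Integrable f) (hf0 : ∀ x, 0 ≤ f x)
    (hf1 : (∫ x : ℝ, f x) = 1) {t1 t2 s : ℝ} (ht1 : 0 < t1) (h12 : t1 ≤ t2) (h2s : t2 < s)
    (P : MvPolynomial ℕ ℝ) : ∀ ε : ℝ, 0 < ε → ε ≤ 1 →
    ∃ C : ℝ, 0 ≤ C ∧ ∀ t, t1 ≤ t → t ≤ t2 → ∀ x,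
      |MvPolynomial.eval (hr f t x) P| ≤ C * (hp f 0 s x / hp f 0 t x) ^ ε := by
  have hs : 0 < s := (ht1.trans_le h12).trans h2s
  induction P using MvPolynomial.induction_on with
  | C r =>
    intro ε hε hε1
    obtain ⟨C, hC, h⟩ := hp_comp hi hf0 ht1 h2s
    refine ⟨|r| * C ^ ε, by positivity, fun t h1 h2 x => ?_⟩
    have hp1 := hp_pos hi hf0 hf1 (ht1.trans_le h1) x
    have hp2 := hp_pos hi hf0 hf1 hs x
    rw [MvPolynomial.eval_C, mul_assoc, ← Real.mul_rpow hC.le (by positivity)]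
    refine le_mul_of_one_le_right (abs_nonneg r) (Real.one_le_rpow ?_ hε.le)
    rw [← mul_div_assoc, le_div_iff₀ hp1, one_mul]
    exact h t h1 h2 x
  | add P Q hP hQ =>
    intro ε hε hε1
    obtain ⟨C1, hC1, h1⟩ := hP ε hε hε1
    obtain ⟨C2, hC2, h2⟩ := hQ ε hε hε1
    refine ⟨C1 + C2, by positivity, fun t ha hb x => ?_⟩
    rw [map_add, add_mul]
    exact (abs_add_le _ _).trans (add_le_add (h1 t ha hb x) (h2 t ha hb x))
  | mul_X P i hP =>
    intro ε hε hε1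
    obtain ⟨C1, hC1, h1⟩ := hP (ε / 2) (by linarith) (by linarith)
    obtain ⟨C2, hC2, h2⟩ := hp_bound hi hf0 hf1 ht1 h2s i (δ := ε / 2) (by linarith) (by linarith)
    refine ⟨C1 * C2, by positivity, fun t ha hb x => ?_⟩
    have hp1 := hp_pos hi hf0 hf1 (ht1.trans_le ha) x
    have hp2 := hp_pos hi hf0 hf1 hs x
    have h3 : |hr f t x i| ≤ C2 * (hp f 0 s x / hp f 0 t x) ^ (ε / 2) := by
      rw [hr, abs_div, abs_of_pos hp1, div_le_iff₀ hp1]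
      refine (h2 t ha hb x).trans (le_of_eq ?_)
      rw [Real.div_rpow hp2.le hp1.le, Real.rpow_sub hp1, Real.rpow_one]
      field_simp
    rw [map_mul, MvPolynomial.eval_X, abs_mul]
    calc _ ≤ (C1 * (hp f 0 s x / hp f 0 t x) ^ (ε / 2)) *
        (C2 * (hp f 0 s x / hp f 0 t x) ^ (ε / 2)) := by
          gcongr
          exact h1 t ha hb x
      _ = C1 * C2 * ((hp f 0 s x / hp f 0 t x) ^ (ε / 2) *
        (hp f 0 s x / hp f 0 t x) ^ (ε / 2)) := by ring
      _ = _ := by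
        rw [← Real.rpow_add (by positivity)]; congr 2; ring

lemma gP_bound {f : ℝ → ℝ} (hi : Integrable f) (hf0 : ∀ x, 0 ≤ f x)
    (hf1 : (∫ x : ℝ, f x) = 1) {t1 t2 s : ℝ} (ht1 : 0 < t1) (h12 : t1 ≤ t2) (h2s : t2 < s)
    {α : ℝ} (hα : 1 / 2 ≤ α) (P : MvPolynomial ℕ ℝ) :
    ∃ C : ℝ, 0 ≤ C ∧ ∀ t, t1 ≤ t → t ≤ t2 → ∀ x, |gP f α P t x| ≤ C * hp f 0 s x ^ α := by
  have hs : 0 < s := (ht1.trans_le h12).trans h2s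
  obtain ⟨C1, hC1, h1⟩ := eval_bound hi hf0 hf1 ht1 h12 h2s P (1 / 2) (by norm_num) (by norm_num)
  obtain ⟨C2, hC2, h2⟩ := hp_comp hi hf0 ht1 h2s
  refine ⟨C1 * C2 ^ (α - 1 / 2), by positivity, fun t ha hb x => ?_⟩
  have hp1 := hp_pos hi hf0 hf1 (ht1.trans_le ha) x
  have hp2 := hp_pos hi hf0 hf1 hs x
  have h3 : hp f 0 t x ^ (α - 1 / 2) ≤ (C2 * hp f 0 s x) ^ (α - 1 / 2) :=
    Real.rpow_le_rpow hp1.le (h2 t ha hb x) (by linarith)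
  rw [gP, abs_mul, abs_of_pos (by positivity)]
  calc _ ≤ hp f 0 t x ^ α * (C1 * (hp f 0 s x / hp f 0 t x) ^ (1 / 2 : ℝ)) := by
        gcongr
        exact h1 t ha hb x
    _ = C1 * (hp f 0 t x ^ (α - 1 / 2) * hp f 0 s x ^ (1 / 2 : ℝ)) := by
      rw [Real.div_rpow hp2.le hp1.le, Real.rpow_sub hp1]
      field_simp
    _ ≤ C1 * ((C2 * hp f 0 s x) ^ (α - 1 / 2) * hp f 0 s x ^ (1 / 2 : ℝ)) := by gcongr
    _ = C1 * (C2 ^ (α - 1 / 2) * (hp f 0 s x ^ (α - 1 / 2) * hp f 0 s x ^ (1 / 2 : ℝ))) := by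
      rw [Real.mul_rpow hC2.le hp2.le]; ring
    _ = _ := by rw [← Real.rpow_add hp2]; ring_nf

lemma gP_integrable {f : ℝ → ℝ} (hi : Integrable f) (hf0 : ∀ x, 0 ≤ f x)
    (hf1 : (∫ x : ℝ, f x) = 1) {α : ℝ} (hα : 1 / 2 ≤ α) {s : ℝ}
    (hs : Integrable (fun x => hp f 0 s x ^ α))
    (P : MvPolynomial ℕ ℝ) {t : ℝ} (ht : 0 < t) (hts : t < s) :
    Integrable (fun x => gP f α P t x) := by
  obtain ⟨C, hC, h⟩ := gP_bound hi hf0 hf1 ht le_rfl hts hα P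
  exact (hs.const_mul C).mono' (gP_continuous hi hf0 hf1 α P ht).aestronglyMeasurable
    (Eventually.of_forall fun x => h t le_rfl le_rfl x)

lemma gP_integral_deriv {f : ℝ → ℝ} (hi : Integrable f) (hf0 : ∀ x, 0 ≤ f x)
    (hf1 : (∫ x : ℝ, f x) = 1) {α : ℝ} (hα : 1 / 2 ≤ α) {s : ℝ}
    (hs : Integrable (fun x => hp f 0 s x ^ α))
    (P : MvPolynomial ℕ ℝ) {t : ℝ} (ht : 0 < t) (hts : t < s) :
    HasDerivAt (fun t => ∫ x, gP f α P t x) ((∫ x, gP f α (Tk α 2 P) t x) / 2) t := by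
  obtain ⟨C, hC, h⟩ := gP_bound hi hf0 hf1 (t1 := t / 2) (t2 := (t + s) / 2) (s := s)
    (by linarith) (by linarith) (by linarith) hα (Tk α 2 P)
  have hmem : Set.Ioo (t / 2) ((t + s) / 2) ∈ nhds t :=
    Ioo_mem_nhds (by linarith) (by linarith)
  have key := (hasDerivAt_integral_of_dominated_loc_of_deriv_le (μ := volume)
    (bound := fun x => C * hp f 0 s x ^ α)
    (F := fun t x => gP f α P t x)
    (s := Set.Ioo (t / 2) ((t + s) / 2)) hmem
    (by filter_upwards [hmem] with r hr
        exact (gP_continuous hi hf0 hf1 α P (by linarith [hr.1])).aestronglyMeasurable)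
    (gP_integrable hi hf0 hf1 hα hs P ht hts) (F' := fun t x => gP f α (Tk α 2 P) t x / 2)
    ((gP_continuous hi hf0 hf1 α (Tk α 2 P) ht).div_const 2).aestronglyMeasurable
    ?_ (hs.const_mul C) ?_).2
  · refine key.congr_deriv ?_
    rw [integral_div]
  · refine Eventually.of_forall fun x r hr => ?_
    rw [Real.norm_eq_abs, abs_div, abs_two]
    have := h r hr.1.le hr.2.le x
    have h0 := abs_nonneg (gP f α (Tk α 2 P) r x)
    linarith
  · refine Eventually.of_forall fun x r hr => ?_
    exact gP_hasDerivAt_t hi hf0 hf1 α P (by linarith [hr.1]) x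

lemma gP_integral_T1 {f : ℝ → ℝ} (hi : Integrable f) (hf0 : ∀ x, 0 ≤ f x)
    (hf1 : (∫ x : ℝ, f x) = 1) {α : ℝ} (hα : 1 / 2 ≤ α) {s : ℝ}
    (hs : Integrable (fun x => hp f 0 s x ^ α))
    (P : MvPolynomial ℕ ℝ) {t : ℝ} (ht : 0 < t) (hts : t < s) :
    ∫ x, gP f α (Tk α 1 P) t x = 0 :=
  integral_eq_zero_of_hasDerivAt_of_integrable
    (fun x => gP_hasDerivAt_x hi hf0 hf1 α P ht x)
    (gP_integrable hi hf0 hf1 hα hs _ ht hts) (gP_integrable hi hf0 hf1 hα hs P ht hts)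

lemma log_bound {C u : ℝ} (hu : 0 < u) (huC : u ≤ C) :
    |Real.log u| * u ^ (1 / 2 : ℝ) ≤ 2 + C * C ^ (1 / 2 : ℝ) := by
  have hC : 0 < C := hu.trans_le huC
  rcases le_total u 1 with h | h
  · have := Real.abs_log_mul_self_rpow_lt u (1 / 2) hu h (by norm_num)
    rw [abs_mul, abs_of_pos (by positivity : 0 < u ^ (1 / 2 : ℝ))] at this
    have h2 : 0 ≤ C * C ^ (1 / 2 : ℝ) := by positivity
    norm_num at this ⊢
    linarith
  · have h1 : |Real.log u| ≤ C := by
      rw [abs_of_nonneg (Real.log_nonneg h)]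
      have := Real.log_le_sub_one_of_pos hu
      linarith
    have h2 : u ^ (1 / 2 : ℝ) ≤ C ^ (1 / 2 : ℝ) := by gcongr
    have : |Real.log u| * u ^ (1 / 2 : ℝ) ≤ C * C ^ (1 / 2 : ℝ) := by gcongr
    linarith

/-- The integrand `log p * p * P`. -/
noncomputable def lP (f : ℝ → ℝ) (P : MvPolynomial ℕ ℝ) (t x : ℝ) : ℝ :=
  Real.log (hp f 0 t x) * gP f 1 P t x

lemma lP_bound {f : ℝ → ℝ} (hi : Integrable f) (hf0 : ∀ x, 0 ≤ f x)
    (hf1 : (∫ x : ℝ, f x) = 1) {t1 t2 s : ℝ} (ht1 : 0 < t1) (h12 : t1 ≤ t2) (h2s : t2 < s)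
    (P : MvPolynomial ℕ ℝ) :
    ∃ C : ℝ, 0 ≤ C ∧ ∀ t, t1 ≤ t → t ≤ t2 → ∀ x,
      |lP f P t x| ≤ C * (|hp f 0 s x * Real.log (hp f 0 s x)| + hp f 0 s x) := by
  have hs : 0 < s := (ht1.trans_le h12).trans h2s
  obtain ⟨C1, hC1, h1⟩ := eval_bound hi hf0 hf1 ht1 h12 h2s P (1 / 2) (by norm_num) (by norm_num)
  obtain ⟨C2, hC2, h2⟩ := hp_comp hi hf0 ht1 h2s
  set A := 2 + C2 * C2 ^ (1 / 2 : ℝ) with hA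
  set B := C2 ^ (1 / 2 : ℝ) with hB
  have hB0 : 0 ≤ B := by positivity
  have hA0 : 0 ≤ A := by positivity
  refine ⟨C1 * (A + B), by positivity, fun t ha hb x => ?_⟩
  have hp1 := hp_pos hi hf0 hf1 (ht1.trans_le ha) x
  have hp2 := hp_pos hi hf0 hf1 hs x
  have h1' := h1 t ha hb x
  have h2' := h2 t ha hb x
  rw [lP, gP, Real.rpow_one, abs_mul, abs_mul, abs_mul]
  set p := hp f 0 t x
  set q := hp f 0 s x
  obtain ⟨u, hu⟩ : ∃ u, u = p / q := ⟨_, rfl⟩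
  have hu0 : 0 < u := by rw [hu]; positivity
  have huC : u ≤ C2 := by rw [hu, div_le_iff₀ hp2]; exact h2'
  have hpq : p = u * q := by rw [hu]; field_simp
  have hlog : |Real.log p| ≤ |Real.log u| + |Real.log q| := by
    rw [hpq, Real.log_mul hu0.ne' hp2.ne']; exact abs_add_le _ _
  have hlb := log_bound hu0 huC
  have hub : u ^ (1 / 2 : ℝ) ≤ B := by rw [hB]; gcongr
  have hqp : (q / p) ^ (1 / 2 : ℝ) = (u ^ (1 / 2 : ℝ))⁻¹ := by
    rw [← Real.inv_rpow hu0.le, hu, inv_div]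
  have huu : u ^ (1 / 2 : ℝ) * u ^ (1 / 2 : ℝ) = u := by
    rw [← Real.rpow_add hu0]; norm_num
  rw [abs_of_pos hp1, abs_of_pos hp2]
  have hsq : 0 < u ^ (1 / 2 : ℝ) := by positivity
  have hpC : p * (C1 * (q / p) ^ (1 / 2 : ℝ)) = C1 * (u ^ (1 / 2 : ℝ) * q) := by
    rw [hqp, hpq]
    nth_rewrite 1 [← huu]
    field_simp
  calc |Real.log p| * (p * |MvPolynomial.eval (hr f t x) P|)
      ≤ (|Real.log u| + |Real.log q|) * (p * (C1 * (q / p) ^ (1 / 2 : ℝ))) := by gcongr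
    _ = C1 * ((|Real.log u| * u ^ (1 / 2 : ℝ)) * q + u ^ (1 / 2 : ℝ) * (q * |Real.log q|)) := by
      rw [hpC]; ring
    _ ≤ C1 * (A * q + B * (q * |Real.log q|)) := by gcongr
    _ ≤ C1 * ((A + B) * (q * |Real.log q| + q)) := by
      gcongr
      have i1 : 0 ≤ B * q := by positivity
      have i2 : 0 ≤ A * (q * |Real.log q|) := by positivity
      nlinarith
    _ = _ := by ring

lemma lP_hasDerivAt_x {f : ℝ → ℝ} (hi : Integrable f) (hf0 : ∀ x, 0 ≤ f x)
    (hf1 : (∫ x : ℝ, f x) = 1) (P : MvPolynomial ℕ ℝ) {t : ℝ} (ht : 0 < t) (x : ℝ) :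
    HasDerivAt (fun x => lP f P t x)
      (gP f 1 (MvPolynomial.X 1 * P) t x + lP f (Tk 1 1 P) t x) x := by
  have hP := hp_pos hi hf0 hf1 ht x
  have h1 := (hp_hasDerivAt_x hi ht 0 x).log hP.ne'
  have h2 := gP_hasDerivAt_x hi hf0 hf1 1 P ht x
  refine (h1.mul h2).congr_deriv ?_
  simp only [lP, gP, map_mul, MvPolynomial.eval_X, hr, zero_add, Real.rpow_one]
  field_simp

lemma lP_hasDerivAt_t {f : ℝ → ℝ} (hi : Integrable f) (hf0 : ∀ x, 0 ≤ f x)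
    (hf1 : (∫ x : ℝ, f x) = 1) (P : MvPolynomial ℕ ℝ) {t : ℝ} (ht : 0 < t) (x : ℝ) :
    HasDerivAt (fun t => lP f P t x)
      ((gP f 1 (MvPolynomial.X 2 * P) t x + lP f (Tk 1 2 P) t x) / 2) t := by
  have hP := hp_pos hi hf0 hf1 ht x
  have h1 := (hp_hasDerivAt_t hi ht 0 x).log hP.ne'
  have h2 := gP_hasDerivAt_t hi hf0 hf1 1 P ht x
  refine (h1.mul h2).congr_deriv ?_
  simp only [lP, gP, map_mul, MvPolynomial.eval_X, hr, zero_add, Real.rpow_one]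
  field_simp

lemma lP_continuous {f : ℝ → ℝ} (hi : Integrable f) (hf0 : ∀ x, 0 ≤ f x)
    (hf1 : (∫ x : ℝ, f x) = 1) (P : MvPolynomial ℕ ℝ) {t : ℝ} (ht : 0 < t) :
    Continuous (fun x => lP f P t x) :=
  continuous_iff_continuousAt.mpr fun x => (lP_hasDerivAt_x hi hf0 hf1 P ht x).continuousAt

lemma lP_integrable {f : ℝ → ℝ} (hi : Integrable f) (hf0 : ∀ x, 0 ≤ f x)
    (hf1 : (∫ x : ℝ, f x) = 1) {s : ℝ}
    (hs : Integrable (fun x => hp f 0 s x * Real.log (hp f 0 s x)))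
    (P : MvPolynomial ℕ ℝ) {t : ℝ} (ht : 0 < t) (hts : t < s) :
    Integrable (fun x => lP f P t x) := by
  obtain ⟨C, hC, h⟩ := lP_bound hi hf0 hf1 ht le_rfl hts P
  exact ((hs.abs.add (hp_integrable_x hi (ht.trans hts))).const_mul C).mono'
    (lP_continuous hi hf0 hf1 P ht).aestronglyMeasurable
    (Eventually.of_forall fun x => h t le_rfl le_rfl x)

lemma gP_one (f : ℝ → ℝ) (α t x : ℝ) : gP f α 1 t x = hp f 0 t x ^ α := by simp [gP]

lemma shannon_deriv {f : ℝ → ℝ} (hi : Integrable f) (hf0 : ∀ x, 0 ≤ f x)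
    (hf1 : (∫ x : ℝ, f x) = 1) {s : ℝ}
    (hs : Integrable (fun x => hp f 0 s x * Real.log (hp f 0 s x)))
    {t : ℝ} (ht : 0 < t) (hts : t < s) :
    HasDerivAt (fun t => -∫ x, hp f 0 t x * Real.log (hp f 0 t x))
      (1 / 2 * ∫ x, gP f 1 (MvPolynomial.X 1 * MvPolynomial.X 1) t x) t := by
  have hs1 : Integrable (fun x => hp f 0 s x ^ (1 : ℝ)) := by
    simpa using hp_integrable_x hi (ht.trans hts)
  have hh : (1 / 2 : ℝ) ≤ 1 := by norm_num
  have ig := fun P => gP_integrable hi hf0 hf1 hh hs1 P ht hts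
  have il := fun P => lP_integrable hi hf0 hf1 hs P ht hts
  obtain ⟨C, hC, h⟩ := lP_bound hi hf0 hf1 (t1 := t / 2) (t2 := (t + s) / 2) (s := s)
    (by linarith) (by linarith) (by linarith) (Tk 1 2 1)
  obtain ⟨C', hC', h'⟩ := gP_bound hi hf0 hf1 (t1 := t / 2) (t2 := (t + s) / 2) (s := s)
    (by linarith) (by linarith) (by linarith) hh (MvPolynomial.X 2 * 1)
  have hmem : Set.Ioo (t / 2) ((t + s) / 2) ∈ nhds t :=
    Ioo_mem_nhds (by linarith) (by linarith)
  have key := (hasDerivAt_integral_of_dominated_loc_of_deriv_le (μ := volume)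
    (bound := fun x => C' * hp f 0 s x ^ (1 : ℝ) +
      C * (|hp f 0 s x * Real.log (hp f 0 s x)| + hp f 0 s x))
    (F := fun t x => lP f 1 t x)
    (s := Set.Ioo (t / 2) ((t + s) / 2)) hmem
    (by filter_upwards [hmem] with r hr
        exact (lP_continuous hi hf0 hf1 1 (by linarith [hr.1])).aestronglyMeasurable)
    (il 1) (F' := fun t x => (gP f 1 (MvPolynomial.X 2 * 1) t x + lP f (Tk 1 2 1) t x) / 2)
    (((ig _).add (il _)).div_const 2).aestronglyMeasurable
    ?_ ((hs1.const_mul C').add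
      ((hs.abs.add (hp_integrable_x hi (ht.trans hts))).const_mul C)) ?_).2
  · have e : (fun t => -∫ x, hp f 0 t x * Real.log (hp f 0 t x)) =
        fun t => -∫ x, lP f 1 t x := by
      funext r
      congr 2
      funext x
      rw [lP, gP_one, Real.rpow_one, mul_comm]
    rw [e]
    refine key.neg.congr_deriv ?_
    rw [integral_div, integral_add (ig _) (il _)]
    have e1 : ∫ x, (gP f 1 (MvPolynomial.X 1 * MvPolynomial.X 1) t x +
        lP f (Tk 1 1 (MvPolynomial.X 1)) t x) = 0 :=
      integral_eq_zero_of_hasDerivAt_of_integrable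
        (fun x => lP_hasDerivAt_x hi hf0 hf1 (MvPolynomial.X 1) ht x)
        ((ig _).add (il _)) (il _)
    rw [integral_add (ig _) (il _)] at e1
    have e2 := gP_integral_T1 hi hf0 hf1 hh hs1 (MvPolynomial.X 1) ht hts
    have e3 : Tk 1 1 (MvPolynomial.X 1) = MvPolynomial.X 2 := by
      simp only [Tk, Dk_X, map_one]
      ring
    have e4 : Tk 1 2 1 = MvPolynomial.X 2 := by
      simp [Tk]
    rw [e3] at e1 e2
    rw [e4, mul_one, e2]
    linarith
  · refine Eventually.of_forall fun x r hr => ?_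
    rw [Real.norm_eq_abs, abs_div, abs_two]
    have i1 := h r hr.1.le hr.2.le x
    have i2 := h' r hr.1.le hr.2.le x
    have i3 := abs_add_le (gP f 1 (MvPolynomial.X 2 * 1) r x) (lP f (Tk 1 2 1) r x)
    have i4 := abs_nonneg (gP f 1 (MvPolynomial.X 2 * 1) r x + lP f (Tk 1 2 1) r x)
    linarith
  · refine Eventually.of_forall fun x r hr => ?_
    exact lP_hasDerivAt_t hi hf0 hf1 1 (by linarith [hr.1]) x

lemma tsallis_deriv {f : ℝ → ℝ} (hi : Integrable f) (hf0 : ∀ x, 0 ≤ f x)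
    (hf1 : (∫ x : ℝ, f x) = 1) {α : ℝ} (hα : 1 / 2 ≤ α) (hα1 : α ≠ 1) {s : ℝ}
    (hs : Integrable (fun x => hp f 0 s x ^ α))
    {t : ℝ} (ht : 0 < t) (hts : t < s) :
    HasDerivAt (fun t => (1 - α)⁻¹ * ((∫ x, hp f 0 t x ^ α) - 1))
      (α / 2 * ∫ x, gP f α (MvPolynomial.X 1 * MvPolynomial.X 1) t x) t := by
  have ig := fun P => gP_integrable hi hf0 hf1 hα hs P ht hts
  have h1 := ((gP_integral_deriv hi hf0 hf1 hα hs 1 ht hts).sub_const 1).const_mul ((1 - α)⁻¹)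
  simp only [gP_one] at h1
  refine h1.congr_deriv ?_
  have e1 := gP_integral_T1 hi hf0 hf1 hα hs (MvPolynomial.X 1) ht hts
  have e2 : ∀ x, gP f α (Tk α 1 (MvPolynomial.X 1)) t x =
      (α - 1) * gP f α (MvPolynomial.X 1 * MvPolynomial.X 1) t x +
        gP f α (MvPolynomial.X 2) t x := by
    intro x
    simp only [gP, Tk, Dk_X, map_add, map_sub, map_mul, MvPolynomial.eval_X, MvPolynomial.eval_C,
      Nat.reduceAdd]
    ring
  have e3 : ∀ x, gP f α (Tk α 2 1) t x = α * gP f α (MvPolynomial.X 2) t x := by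
    intro x
    simp only [gP, Tk, Derivation.map_one_eq_zero, map_add, map_mul, MvPolynomial.eval_X,
      MvPolynomial.eval_C, map_one, map_zero]
    ring
  simp only [e2] at e1
  rw [integral_add ((ig _).const_mul _) (ig _), integral_const_mul] at e1
  simp only [e3]
  rw [integral_const_mul]
  have h0 : 1 - α ≠ 0 := sub_ne_zero.mpr hα1.symm
  have e4 : ∫ x, gP f α (MvPolynomial.X 2) t x =
      (1 - α) * ∫ x, gP f α (MvPolynomial.X 1 * MvPolynomial.X 1) t x := by linarith
  rw [e4]
  field_simp

lemma main_aux {f : ℝ → ℝ} (hi : Integrable f) (hf0 : ∀ x, 0 ≤ f x)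
    (hf1 : (∫ x : ℝ, f x) = 1) {α : ℝ} (hαl : 0.93 ≤ α) (hαu : α ≤ 2) {s : ℝ}
    (hs : Integrable (fun x => hp f 0 s x ^ α)) (F : ℝ → ℝ)
    (hF : ∀ t, 0 < t → t < s → HasDerivAt F
      (α / 2 * ∫ x, gP f α (MvPolynomial.X 1 * MvPolynomial.X 1) t x) t)
    {t : ℝ} (ht : 0 < t) (hts : t < s) : iteratedDeriv 4 F t ≤ 0 := by
  have hα : 1 / 2 ≤ α := by norm_num at hαl; linarith
  have step : ∀ (n : ℕ) (c : ℝ) (P : MvPolynomial ℕ ℝ),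
      (∀ t, 0 < t → t < s → iteratedDeriv n F t = c * ∫ x, gP f α P t x) →
      ∀ t, 0 < t → t < s → iteratedDeriv (n + 1) F t = c / 2 * ∫ x, gP f α (Tk α 2 P) t x := by
    intro n c P h t ht hts
    rw [iteratedDeriv_succ]
    have he : iteratedDeriv n F =ᶠ[nhds t] fun t => c * ∫ x, gP f α P t x := by
      filter_upwards [Ioo_mem_nhds ht hts] with r hr
      exact h r hr.1 hr.2
    rw [he.deriv_eq, ((gP_integral_deriv hi hf0 hf1 hα hs P ht hts).const_mul c).deriv]
    ring
  have h1 : ∀ t, 0 < t → t < s → iteratedDeriv 1 F t =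
      α / 2 * ∫ x, gP f α (MvPolynomial.X 1 * MvPolynomial.X 1) t x := by
    intro t ht hts
    rw [iteratedDeriv_one]
    exact (hF t ht hts).deriv
  have h4 := step 3 _ _ (step 2 _ _ (step 1 _ _ h1)) t ht hts
  rw [h4]
  obtain ⟨M, hM⟩ := cert_exists α hαl hαu
  have ig := fun P => gP_integrable hi hf0 hf1 hα hs P ht hts
  have e1 := gP_integral_T1 hi hf0 hf1 hα hs M ht hts
  have e2 : (∫ x, (gP f α (Tk α 2 (Tk α 2 (Tk α 2
      (MvPolynomial.X 1 * MvPolynomial.X 1)))) t x + gP f α (Tk α 1 M) t x)) ≤ 0 := by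
    refine integral_nonpos fun x => ?_
    have hp0 := hp_pos hi hf0 hf1 ht x
    simp only [gP, Pi.zero_apply]
    rw [← mul_add]
    exact mul_nonpos_of_nonneg_of_nonpos (by positivity) (hM _)
  rw [integral_add (ig _) (ig _), e1, add_zero] at e2
  exact mul_nonpos_of_nonneg_of_nonpos (by positivity) e2

lemma heatP_eq (f : ℝ → ℝ) (t x : ℝ) : heatP f t x = hp f 0 t x := by
  simp only [heatP, hp, gk_zero]

/-- Nonpositivity of the fourth-order derivative of the Tsallis entropy along the heat
flow, for orders α ∈ [0.93, 2]. -/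
theorem tsallis_fourth_derivative_nonpos
    (f : ℝ → ℝ) (hfm : Measurable f) (hf0 : ∀ x, 0 ≤ f x)
    (hf1 : (∫ x : ℝ, f x) = 1)
    (α : ℝ) (hαl : 0.93 ≤ α) (hαu : α ≤ 2)
    (t : ℝ) (ht : 0 < t) (htα : ltTalpha f α t) :
    iteratedDeriv 4 (fun s => tsallisEnt f α s) t ≤ 0 := by
  have hi : Integrable f := by
    by_contra h
    rw [integral_undef h] at hf1
    exact zero_ne_one hf1
  obtain ⟨s, hts, hs, hfin⟩ := htα
  unfold renyiFinite at hfin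
  simp only [heatP_eq] at hfin
  by_cases h1 : α = 1
  · subst h1
    rw [if_pos rfl] at hfin
    refine main_aux hi hf0 hf1 hαl hαu (s := s) (by simpa using hp_integrable_x hi hs) _ ?_ ht hts
    intro r hr hrs
    have := shannon_deriv hi hf0 hf1 hfin hr hrs
    simpa only [tsallisEnt, heatP_eq, if_true] using this
  · rw [if_neg h1] at hfin
    refine main_aux hi hf0 hf1 hαl hαu hfin.1 _ ?_ ht hts
    intro r hr hrs
    have := tsallis_deriv hi hf0 hf1 (by norm_num at hαl; linarith) h1 hfin.1 hr hrs
    simpa only [tsallisEnt, heatP_eq, if_neg h1] using this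
end

section
/- Suppose f has finite variance and t_α = ∞, and let k be a positive integer and α ∈ (1/3, +∞) be such that t ↦ h_α(p(·,t)) is (k+1)-times differentiable on (0,∞). If ∂^{k+1} h_α(p(·,t))/∂t^{k+1} ≤ 0 for all t > 0, then ∂^k h_α(p(·,t))/∂t^k ≥ 0 for all t > 0; likewise, if ∂^{k+1} h_α(p(·,t))/∂t^{k+1} ≥ 0 for all t > 0, then ∂^k h_α(p(·,t))/∂t^k ≤ 0 for all t > 0. -/
open MeasureTheory Real Filter
open scoped Classical

lemma growth_aux (h : ℝ → ℝ) (k : ℕ) :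
    (∀ j ≤ k, ∀ t : ℝ, 0 < t → DifferentiableAt ℝ (iteratedDeriv j h) t) →
    ∀ c T : ℝ, 0 < c → 0 < T → (∀ t, T ≤ t → c ≤ iteratedDeriv (k + 1) h t) →
    ∃ c' K T' : ℝ, 0 < c' ∧ ∀ t, T' ≤ t → c' * t - K ≤ h t := by
  induction k with
  | zero =>
    intro hd c T hc hT hb
    refine ⟨c, c * T - h T, T, hc, fun t ht => ?_⟩
    have := (convex_Ici T).mul_sub_le_image_sub_of_le_deriv (f := h) (C := c)
      (fun x hx => by
        have := hd 0 le_rfl x (lt_of_lt_of_le hT hx)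
        rw [iteratedDeriv_zero] at this
        exact this.continuousAt.continuousWithinAt)
      (fun x hx => by
        have := hd 0 le_rfl x (lt_of_lt_of_le hT (interior_subset hx))
        rw [iteratedDeriv_zero] at this
        exact this.differentiableWithinAt)
      (fun x hx => by
        have := hb x (interior_subset hx)
        rwa [zero_add, iteratedDeriv_one] at this) T Set.self_mem_Ici t ht ht
    linarith
  | succ k ih =>
    intro hd c T hc hT hb
    have key : ∀ t, T ≤ t →
        c * (t - T) ≤ iteratedDeriv (k + 1) h t - iteratedDeriv (k + 1) h T := fun t ht =>
      (convex_Ici T).mul_sub_le_image_sub_of_le_deriv (f := iteratedDeriv (k + 1) h) (C := c)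
      (fun x hx =>
        (hd (k + 1) le_rfl x (lt_of_lt_of_le hT hx)).continuousAt.continuousWithinAt)
      (fun x hx => 
        (hd (k + 1) le_rfl x (lt_of_lt_of_le hT (interior_subset hx))).differentiableWithinAt)
      (fun x hx => by
        have := hb x (interior_subset hx)
        rwa [iteratedDeriv_succ] at this) T Set.self_mem_Ici t ht ht
    set G := iteratedDeriv (k + 1) h T
    refine ih (fun j hj => hd j (by omega)) 1 (T + (1 + |G|) / c) one_pos (by positivity) ?_
    intro t ht
    have h1 : T ≤ t := le_trans (by have : 0 ≤ (1 + |G|) / c := by positivity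
                                    linarith) ht
    have h2 := key t h1
    have h3 : (1 + |G|) ≤ c * (t - T) := by
      have : (1 + |G|) / c ≤ t - T := by linarith
      rwa [div_le_iff₀' hc] at this
    have := neg_abs_le G
    linarith

lemma sign_aux (h : ℝ → ℝ) (k : ℕ) (hk : 1 ≤ k)
    (hd : ∀ j ≤ k, ∀ t : ℝ, 0 < t → DifferentiableAt ℝ (iteratedDeriv j h) t)
    (hu : ∀ ε : ℝ, 0 < ε → ∃ C T : ℝ, ∀ t, T ≤ t → h t ≤ C + ε * t)
    (hs : ∀ t : ℝ, 0 < t → 0 ≤ iteratedDeriv (k + 1) h t) :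
    ∀ t : ℝ, 0 < t → iteratedDeriv k h t ≤ 0 := by
  intro T hT
  by_contra! hpos
  obtain ⟨m, rfl⟩ : ∃ m, k = m + 1 := ⟨k - 1, by omega⟩
  have key : ∀ t, T ≤ t → iteratedDeriv (m + 1) h T ≤ iteratedDeriv (m + 1) h t := by
    intro t ht
    have := (convex_Ici T).mul_sub_le_image_sub_of_le_deriv
      (f := iteratedDeriv (m + 1) h) (C := 0)
      (fun x hx =>
        (hd (m + 1) le_rfl x (lt_of_lt_of_le hT hx)).continuousAt.continuousWithinAt)
      (fun x hx => 
        (hd (m + 1) le_rfl x (lt_of_lt_of_le hT (interior_subset hx))).differentiableWithinAt)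
      (fun x hx => by
        have := hs x (lt_of_lt_of_le hT (interior_subset hx))
        rwa [iteratedDeriv_succ] at this) T Set.self_mem_Ici t ht ht
    linarith
  obtain ⟨c, K, T', hc, hb⟩ := growth_aux h m (fun j hj => hd j (by omega)) _ T hpos hT key
  obtain ⟨C, T'', hC⟩ := hu (c / 2) (by positivity)
  let t := max (max T' T'') ((C + K + 1) * 2 / c)
  have h1 := hb t (le_trans (le_max_left _ _) (le_max_left _ _))
  have h2 := hC t (le_trans (le_max_right _ _) (le_max_left _ _))
  have h3 : (C + K + 1) * 2 / c ≤ t := le_max_right _ _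
  rw [div_le_iff₀ hc] at h3
  linarith

lemma gauss_facts (t : ℝ) (ht : 0 < t) :
    let g : ℝ → ℝ := fun z => (Real.sqrt (2 * Real.pi * t))⁻¹ * Real.exp (-z ^ 2 / (2 * t))
    Integrable g ∧ ∫ z, g z = 1 ∧ Integrable (fun z => z ^ 2 * g z) ∧
      ∫ z, z ^ 2 * g z = t := by
  intro g
  obtain ⟨v, hvt⟩ : ∃ v : NNReal, (v : ℝ) = t := ⟨t.toNNReal, Real.coe_toNNReal t ht.le⟩
  have hg : g = ProbabilityTheory.gaussianPDFReal 0 v := by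
    funext z
    simp only [g, ProbabilityTheory.gaussianPDFReal, sub_zero, hvt]
  have hv : v ≠ 0 := by
    rintro rfl
    exact ht.ne hvt
  have hm := ProbabilityTheory.memLp_id_gaussianReal (μ := 0) (v := v) 2
  have hi : Integrable (fun z => z ^ 2 * g z) := by
    have := hm.integrable_sq
    rw [ProbabilityTheory.gaussianReal_of_var_ne_zero _ hv,
      integrable_withDensity_iff (ProbabilityTheory.measurable_gaussianPDF _ _)
      (Eventually.of_forall fun _ => ProbabilityTheory.gaussianPDF_lt_top)] at this
    simpa [ProbabilityTheory.toReal_gaussianPDF, hg] using this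
  refine ⟨?_, ?_, hi, ?_⟩
  · rw [hg]; exact ProbabilityTheory.integrable_gaussianPDFReal _ _
  · rw [hg]; exact ProbabilityTheory.integral_gaussianPDFReal_eq_one _ hv
  · have h1 := ProbabilityTheory.variance_id_gaussianReal (μ := 0) (v := v)
    rw [ProbabilityTheory.variance_eq_integral aemeasurable_id] at h1
    simp only [id, ProbabilityTheory.integral_id_gaussianReal, sub_zero] at h1
    rw [ProbabilityTheory.integral_gaussianReal_eq_integral_smul hv] at h1
    simp only [smul_eq_mul] at h1
    rw [hg, ← hvt, ← h1]
    congr 1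
    funext z
    ring

lemma heat_facts (f : ℝ → ℝ) (hf0 : ∀ x, 0 ≤ f x) (hf1 : (∫ x : ℝ, f x) = 1)
    (hvar : Integrable (fun x : ℝ => x ^ 2 * f x)) (t : ℝ) (ht : 0 < t) :
    (∀ x, 0 ≤ heatP f t x) ∧ Integrable (heatP f t) ∧ ∫ x, heatP f t x = 1 ∧
    Integrable (fun x => x ^ 2 * heatP f t x) ∧
    ∫ x, x ^ 2 * heatP f t x ≤ 2 * (∫ x, x ^ 2 * f x) + 2 * t ∧
    (1 ≤ t → ∀ x, heatP f t x ≤ 1) := by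
  have hfi : Integrable f := by
    by_contra h
    rw [integral_undef h] at hf1
    norm_num at hf1
  obtain ⟨hg, hg1, hg2, hg3⟩ := gauss_facts t ht
  set g : ℝ → ℝ := fun z => (Real.sqrt (2 * Real.pi * t))⁻¹ * Real.exp (-z ^ 2 / (2 * t)) with hgdef
  have hg0 : ∀ z, 0 ≤ g z := fun z => by positivity
  let L := ContinuousLinearMap.mul ℝ ℝ
  have hp : ∀ x, heatP f t x = ∫ y, f y * g (x - y) := fun x => rfl
  have hpc : heatP f t = convolution f g L volume := rfl
  have hpos : ∀ x, 0 ≤ heatP f t x := fun x => by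
    rw [hp]; exact integral_nonneg fun y => mul_nonneg (hf0 y) (hg0 _)
  have hpi : Integrable (heatP f t) := by rw [hpc]; exact hfi.integrable_convolution L hg
  have e1 := hvar.ae_convolution_exists L hg
  have e2 := hfi.ae_convolution_exists L hg2
  have e3 := hfi.ae_convolution_exists L hg
  have i1 := hvar.integrable_convolution L hg
  have i2 := hfi.integrable_convolution L hg2
  have hle : ∀ᵐ x, x ^ 2 * heatP f t x ≤
      2 * convolution (fun x : ℝ => x ^ 2 * f x) g L volume x
        + 2 * convolution f (fun z => z ^ 2 * g z) L volume x := by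
    filter_upwards [e1, e2, e3] with x h1 h2 h3
    rw [hp, convolution_def, convolution_def, ← integral_const_mul, ← integral_const_mul,
      ← integral_const_mul, ← integral_add (h1.const_mul 2) (h2.const_mul 2)]
    refine integral_mono (Integrable.const_mul h3 _) ((h1.const_mul 2).add (h2.const_mul 2)) ?_
    intro y
    simp only [L, ContinuousLinearMap.mul_apply', Pi.add_apply]
    have : 0 ≤ f y * g (x - y) := mul_nonneg (hf0 y) (hg0 _)
    have h5 : x ^ 2 ≤ 2 * y ^ 2 + 2 * (x - y) ^ 2 := by nlinarith [sq_nonneg (x - 2 * y)]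
    nlinarith [mul_le_mul_of_nonneg_right h5 this]
  have hx2 : Integrable (fun x => x ^ 2 * heatP f t x) := by
    refine Integrable.mono' ((i1.const_mul 2).add (i2.const_mul 2))
      ((continuous_pow 2).aestronglyMeasurable.mul hpi.aestronglyMeasurable) ?_
    filter_upwards [hle] with x hx
    rw [Real.norm_of_nonneg (mul_nonneg (sq_nonneg _) (hpos x))]
    exact hx
  refine ⟨hpos, hpi, ?_, hx2, ?_, ?_⟩
  · rw [hpc, integral_convolution L hfi hg, hf1, hg1]; simp [L]
  · refine (integral_mono_ae hx2 ((i1.const_mul 2).add (i2.const_mul 2)) hle).trans ?_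
    simp only [Pi.add_apply]
    rw [integral_add (i1.const_mul 2) (i2.const_mul 2), integral_const_mul, integral_const_mul,
      integral_convolution L hvar hg, integral_convolution L hfi hg2, hf1, hg1, hg3]
    simp [L]
  · intro h1 x
    rw [hp, ← hf1]
    refine integral_mono_of_nonneg (Eventually.of_forall fun y => mul_nonneg (hf0 y) (hg0 _)) hfi
      (Eventually.of_forall fun y => ?_)
    have : g (x - y) ≤ 1 := by
      refine mul_le_one₀ (inv_le_one_of_one_le₀ ?_) (by positivity) ?_
      · rw [Real.one_le_sqrt]; nlinarith [Real.pi_gt_three]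
      · rw [Real.exp_le_one_iff]
        apply div_nonpos_of_nonpos_of_nonneg
        · nlinarith [sq_nonneg (x - y)]
        · positivity
    simpa using mul_le_mul_of_nonneg_left this (hf0 y)

lemma ent_nonneg (f : ℝ → ℝ) (α t : ℝ) (hfin : renyiFinite f α t)
    (hp0 : ∀ x, 0 ≤ heatP f t x) (hp1 : ∀ x, heatP f t x ≤ 1) (hi : Integrable (heatP f t))
    (h1 : ∫ x, heatP f t x = 1) : 0 ≤ renyiEnt f α t := by
  unfold renyiEnt
  unfold renyiFinite at hfin
  split_ifs at hfin ⊢ with h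
  · rw [neg_nonneg]
    exact integral_nonpos fun x =>
      mul_nonpos_of_nonneg_of_nonpos (hp0 x) (Real.log_nonpos (hp0 x) (hp1 x))
  · rcases lt_or_gt_of_ne h with h | h
    · refine mul_nonneg (inv_nonneg.2 (by linarith)) (Real.log_nonneg ?_)
      rw [← h1]
      refine integral_mono hi hfin.1 fun x => ?_
      rcases (hp0 x).eq_or_lt with h0 | h0
      · simp only [← h0]; exact Real.rpow_nonneg le_rfl _
      · simpa using Real.rpow_le_rpow_of_exponent_ge h0 (hp1 x) h.le
    · refine mul_nonneg_of_nonpos_of_nonpos (inv_nonpos.2 (by linarith))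
        (Real.log_nonpos hfin.2.le ?_)
      rw [← h1]
      refine integral_mono hfin.1 hi fun x => ?_
      rcases (hp0 x).eq_or_lt with h0 | h0
      · simp only [← h0]; rw [Real.zero_rpow (by linarith)]
      · simpa using Real.rpow_le_rpow_of_exponent_ge h0 (hp1 x) h.le

lemma upper_lt (α : ℝ) (hα : 1 / 3 < α) (h1 : α < 1) : ∃ K : ℝ, 0 ≤ K ∧
    ∀ (p : ℝ → ℝ) (A : ℝ), 1 ≤ A → (∀ x, 0 ≤ p x) → Integrable p → ∫ x, p x = 1 →
      Integrable (fun x => x ^ 2 * p x) → 1 + ∫ x, x ^ 2 * p x ≤ A →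
      Integrable (fun x => p x ^ α) → ∫ x, p x ^ α ≤ A ^ α * (α + K) := by
  have hb : 0 < 1 - α := by linarith
  have hW : Integrable (fun x : ℝ => (1 + x ^ 2) ^ (-(α / (1 - α)))) := by
    have := integrable_rpow_neg_one_add_norm_sq (E := ℝ) (μ := volume) (r := 2 * (α / (1 - α)))
      (by
        simp only [Module.finrank_self, Nat.cast_one]
        rw [← mul_div_assoc, lt_div_iff₀ hb]; linarith)
    refine this.congr (Eventually.of_forall fun x => ?_)
    simp only [Real.norm_eq_abs, sq_abs]
    congr 1; ring
  refine ⟨(1 - α) * ∫ x : ℝ, (1 + x ^ 2) ^ (-(α / (1 - α))),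
    mul_nonneg hb.le (integral_nonneg fun x => by positivity), ?_⟩
  intro p A hA hp hpi hp1 hx2 hxA hpa
  have hA0 : 0 < A := by linarith
  have hpt : ∀ x, p x ^ α ≤ A ^ α * (α / A * (p x + x ^ 2 * p x)
      + (1 - α) * (1 + x ^ 2) ^ (-(α / (1 - α)))) := by
    intro x
    have hw : 0 < 1 + x ^ 2 := by positivity
    have := Real.geom_mean_le_arith_mean2_weighted (w₁ := α) (w₂ := 1 - α)
      (p₁ := p x * (1 + x ^ 2) / A) (p₂ := (1 + x ^ 2) ^ (-(α / (1 - α)))) (by linarith) hb.le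
      (div_nonneg (mul_nonneg (hp x) hw.le) hA0.le) (by positivity) (by ring)
    rw [← Real.rpow_mul hw.le, Real.div_rpow (mul_nonneg (hp x) hw.le) hA0.le,
      Real.mul_rpow (hp x) hw.le,
      show -(α / (1 - α)) * (1 - α) = -α by field_simp, Real.rpow_neg hw.le] at this
    have hwa : 0 < (1 + x ^ 2) ^ α := by positivity
    have hAa : 0 < A ^ α := by positivity
    have e : p x ^ α * (1 + x ^ 2) ^ α / A ^ α * ((1 + x ^ 2) ^ α)⁻¹ = p x ^ α / A ^ α := by
      field_simp
    rw [e, div_le_iff₀' hAa] at this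
    refine this.trans (le_of_eq ?_)
    ring
  have hI : Integrable (fun x => α / A * (p x + x ^ 2 * p x)) := (hpi.add hx2).const_mul _
  refine (integral_mono hpa ((hI.add (hW.const_mul (1 - α))).const_mul (A ^ α)) hpt).trans ?_
  simp only [Pi.add_apply]
  rw [integral_const_mul, integral_add hI (hW.const_mul _), integral_const_mul,
    integral_const_mul, integral_add hpi hx2, hp1]
  have : α / A * (1 + ∫ x, x ^ 2 * p x) ≤ α := by
    calc _ ≤ α / A * A := mul_le_mul_of_nonneg_left hxA (by positivity)
      _ = α := by field_simp
  gcongr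

lemma upper_gt (α : ℝ) (h1 : 1 < α) (p : ℝ → ℝ) (A : ℝ) (hA : 1 ≤ A) (hp : ∀ x, 0 ≤ p x)
    (hpi : Integrable p) (hp1 : ∫ x, p x = 1) (hx2 : Integrable (fun x => x ^ 2 * p x))
    (hxA : 1 + ∫ x, x ^ 2 * p x ≤ A) (hpa : Integrable (fun x => p x ^ α)) :
    (4 * A) ^ (-α) ≤ ∫ x, p x ^ α := by
  have hA0 : 0 < A := by linarith
  set c : ℝ := (4 * A)⁻¹ with hc
  have hc0 : 0 < c := by positivity
  have hca : 0 < c ^ α := by positivity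
  have hpt : ∀ x, c ^ α * (α * (4 * A) * (p x - (x ^ 2 * p x) / A ^ 2)
      - (Set.Icc (-A) A).indicator (fun _ => α - 1) x) ≤ p x ^ α := by
    intro x
    by_cases hx : x ∈ Set.Icc (-A) A
    · rw [Set.indicator_of_mem hx]
      have h2 := one_add_mul_self_le_rpow_one_add (s := p x / c - 1)
        (by have := div_nonneg (hp x) hc0.le; linarith) h1.le
      rw [show 1 + (p x / c - 1) = p x / c by ring, Real.div_rpow (hp x) hc0.le,
        le_div_iff₀' hca] at h2
      refine le_trans (mul_le_mul_of_nonneg_left ?_ hca.le) h2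
      have h3 : p x / c = 4 * A * p x := by rw [hc]; field_simp
      rw [h3]
      have h4 : 0 ≤ α * (4 * A) * ((x ^ 2 * p x) / A ^ 2) := by
        have := hp x
        positivity
      nlinarith
    · rw [Set.indicator_of_notMem hx, sub_zero]
      refine le_trans ?_ (Real.rpow_nonneg (hp x) _)
      refine mul_nonpos_of_nonneg_of_nonpos hca.le (mul_nonpos_of_nonneg_of_nonpos (by positivity) ?_)
      have h5 : A ^ 2 ≤ x ^ 2 := by
        rw [Set.mem_Icc, ← abs_le, not_le] at hx
        rw [sq_le_sq, abs_of_pos hA0]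
        exact hx.le
      rw [sub_nonpos, le_div_iff₀ (by positivity)]
      nlinarith [mul_le_mul_of_nonneg_right h5 (hp x)]
  have hind : Integrable ((Set.Icc (-A) A).indicator (fun _ : ℝ => α - 1)) := by
    rw [integrable_indicator_iff measurableSet_Icc]
    exact integrableOn_const (by simp)
  have hI : Integrable (fun x => α * (4 * A) * (p x - (x ^ 2 * p x) / A ^ 2)) :=
    (hpi.sub (hx2.div_const _)).const_mul _
  refine le_trans ?_ (integral_mono ((hI.sub hind).const_mul (c ^ α)) hpa hpt)
  simp only [Pi.sub_apply]
  rw [integral_const_mul, integral_sub hI hind, integral_const_mul,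
    integral_sub hpi (hx2.div_const _), hp1, integral_div, integral_indicator measurableSet_Icc,
    setIntegral_const]
  have hv : (volume : Measure ℝ).real (Set.Icc (-A) A) = 2 * A := by
    rw [Real.volume_real_Icc_of_le (by linarith)]; ring
  rw [hv, smul_eq_mul]
  have e : (4 * A) ^ (-α) = c ^ α * 1 := by
    rw [hc, Real.inv_rpow (by positivity), Real.rpow_neg (by positivity), mul_one]
  rw [e]
  refine mul_le_mul_of_nonneg_left ?_ hca.le
  have h6 : (∫ x, x ^ 2 * p x) / A ^ 2 ≤ 1 / 2 := by
    rw [div_le_iff₀ (by positivity)]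
    nlinarith [sq_nonneg (A - 1)]
  nlinarith [mul_le_mul_of_nonneg_left h6 (show 0 ≤ α * (4 * A) by positivity)]

lemma upper_eq (p : ℝ → ℝ) (A : ℝ) (hA : 1 ≤ A) (hp : ∀ x, 0 ≤ p x)
    (hpi : Integrable p) (hp1 : ∫ x, p x = 1) (hx2 : Integrable (fun x => x ^ 2 * p x))
    (hxA : 1 + ∫ x, x ^ 2 * p x ≤ A) (hpa : Integrable (fun x => p x * Real.log (p x))) :
    -∫ x, p x * Real.log (p x) ≤ Real.pi + Real.log A := by
  have hA0 : 0 < A := by linarith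
  have hpt : ∀ x, -(p x * Real.log (p x)) ≤ (1 + x ^ 2)⁻¹ - p x + (Real.log A - 1) * p x +
      (p x + x ^ 2 * p x) / A := by
    intro x
    have hw : 0 < 1 + x ^ 2 := by positivity
    rcases (hp x).eq_or_lt with h0 | h0
    · rw [← h0]; simp; positivity
    · have h2 := Real.log_le_sub_one_of_pos (x := (1 + x ^ 2)⁻¹ / p x) (by positivity)
      rw [Real.log_div (by positivity) h0.ne', Real.log_inv] at h2
      have h3 := Real.log_le_sub_one_of_pos (x := (1 + x ^ 2) / A) (by positivity)
      rw [Real.log_div (by positivity) hA0.ne'] at h3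
      have h4 : -Real.log (p x) ≤ (1 + x ^ 2)⁻¹ / p x - 1 + (Real.log A - 1) + (1 + x ^ 2) / A := by
        linarith
      have h5 := mul_le_mul_of_nonneg_left h4 h0.le
      have h6 : p x * ((1 + x ^ 2)⁻¹ / p x - 1 + (Real.log A - 1) + (1 + x ^ 2) / A) =
        (1 + x ^ 2)⁻¹ - p x + (Real.log A - 1) * p x + (p x + x ^ 2 * p x) / A := by
        field_simp
      linarith
  have I1 : Integrable (fun x => (1 + x ^ 2)⁻¹ - p x) := integrable_inv_one_add_sq.sub hpi
  have I2 : Integrable (fun x => (Real.log A - 1) * p x) := hpi.const_mul _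
  have I3 : Integrable (fun x => (p x + x ^ 2 * p x) / A) := (hpi.add hx2).div_const _
  have I12 : Integrable (fun x => (1 + x ^ 2)⁻¹ - p x + (Real.log A - 1) * p x) := I1.add I2
  rw [← integral_neg]
  refine (integral_mono hpa.neg (I12.add I3) hpt).trans ?_
  simp only [Pi.add_apply]
  rw [integral_add I12 I3, integral_add I1 I2, integral_sub integrable_inv_one_add_sq hpi,
    integral_const_mul, integral_div, integral_add hpi hx2, hp1, integral_univ_inv_one_add_sq]
  have : (1 + ∫ x, x ^ 2 * p x) / A ≤ 1 := by rw [div_le_one hA0]; exact hxA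
  linarith

lemma ent_upper (f : ℝ → ℝ) (α : ℝ) (hα : 1 / 3 < α) : ∃ C D : ℝ, 0 ≤ D ∧
    ∀ t A : ℝ, renyiFinite f α t → 1 ≤ A → (∀ x, 0 ≤ heatP f t x) → Integrable (heatP f t) →
      ∫ x, heatP f t x = 1 → Integrable (fun x => x ^ 2 * heatP f t x) →
      1 + ∫ x, x ^ 2 * heatP f t x ≤ A → renyiEnt f α t ≤ C + D * Real.log A := by
  rcases lt_trichotomy α 1 with h | h | h
  · obtain ⟨K, hK, hb⟩ := upper_lt α hα h
    have hb1 : 0 < 1 - α := by linarith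
    refine ⟨(1 - α)⁻¹ * Real.log (α + K), (1 - α)⁻¹ * α,
      mul_nonneg (inv_nonneg.2 hb1.le) (by linarith), ?_⟩
    intro t A hfin hA hp hpi hp1 hx2 hxA
    simp only [renyiFinite, renyiEnt, if_neg h.ne] at hfin ⊢
    have h2 := Real.log_le_log hfin.2 (hb _ A hA hp hpi hp1 hx2 hxA hfin.1)
    have hA0 : 0 < A := by linarith
    have hs : 0 < α + K := by linarith
    rw [Real.log_mul (by positivity) hs.ne', Real.log_rpow hA0] at h2
    have := mul_le_mul_of_nonneg_left h2 (inv_nonneg.2 hb1.le)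
    linarith
  · refine ⟨Real.pi, 1, zero_le_one, ?_⟩
    intro t A hfin hA hp hpi hp1 hx2 hxA
    simp only [renyiFinite, renyiEnt, if_pos h] at hfin ⊢
    have := upper_eq _ A hA hp hpi hp1 hx2 hxA hfin
    linarith
  · have hb1 : 0 < α - 1 := by linarith
    refine ⟨(α - 1)⁻¹ * (α * Real.log 4), (α - 1)⁻¹ * α,
      mul_nonneg (inv_nonneg.2 hb1.le) (by linarith), ?_⟩
    intro t A hfin hA hp hpi hp1 hx2 hxA
    simp only [renyiFinite, renyiEnt, if_neg h.ne'] at hfin ⊢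
    have hA0 : 0 < A := by linarith
    have h2 := Real.log_le_log (by positivity) (upper_gt α h _ A hA hp hpi hp1 hx2 hxA hfin.1)
    rw [Real.log_rpow (by positivity), Real.log_mul (by norm_num) hA0.ne'] at h2
    have := mul_le_mul_of_nonneg_left h2 (inv_nonneg.2 hb1.le)
    rw [show (1 - α)⁻¹ = -(α - 1)⁻¹ by rw [← neg_sub, inv_neg]]
    linarith

/-- If the (k+1)-th derivative of the Rényi entropy has a constant sign on (0,∞), then
the k-th derivative has the opposite constant sign, for α > 1/3 (assuming f has finite
variance and t_α = ∞). -/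
theorem renyi_derivative_sign_propagation
    (f : ℝ → ℝ) (hfm : Measurable f) (hf0 : ∀ x, 0 ≤ f x)
    (hf1 : (∫ x : ℝ, f x) = 1)
    (hvar : Integrable (fun x : ℝ => x ^ 2 * f x))
    (α : ℝ) (hα : 1 / 3 < α)
    (htα : ∀ t : ℝ, 0 < t → renyiFinite f α t)
    (k : ℕ) (hk : 1 ≤ k)
    (hdiff : ∀ j ≤ k, ∀ t : ℝ, 0 < t →
      DifferentiableAt ℝ (iteratedDeriv j (fun s => renyiEnt f α s)) t) :
    ((∀ t : ℝ, 0 < t → iteratedDeriv (k + 1) (fun s => renyiEnt f α s) t ≤ 0) →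
      ∀ t : ℝ, 0 < t → 0 ≤ iteratedDeriv k (fun s => renyiEnt f α s) t)
    ∧ ((∀ t : ℝ, 0 < t → 0 ≤ iteratedDeriv (k + 1) (fun s => renyiEnt f α s) t) →
      ∀ t : ℝ, 0 < t → iteratedDeriv k (fun s => renyiEnt f α s) t ≤ 0) := by
  have hH := fun t ht => heat_facts f hf0 hf1 hvar t ht
  constructor
  · intro hs t ht
    have hneg : ∀ j s, iteratedDeriv j (fun s => -renyiEnt f α s) s =
        -iteratedDeriv j (fun s => renyiEnt f α s) s := fun j s => iteratedDeriv_fun_neg _ _ _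
    have := sign_aux (fun s => -renyiEnt f α s) k hk
      (fun j hj s hs => by
        rw [show iteratedDeriv j (fun s => -renyiEnt f α s) =
          fun s => -iteratedDeriv j (fun s => renyiEnt f α s) s from funext (hneg j)]
        exact (hdiff j hj s hs).fun_neg)
      (fun ε hε => ⟨0, 1, fun s hs => by
        have hs0 : 0 < s := by linarith
        obtain ⟨a, b, c, _, _, d⟩ := hH s hs0
        have := ent_nonneg f α s (htα s hs0) a (d hs) b c
        have : 0 < ε * s := by positivity
        linarith⟩)
      (fun s h0 => by
        rw [hneg]
        have := hs s h0
        linarith) t ht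
    rw [hneg] at this
    linarith
  · intro hs
    refine sign_aux _ k hk hdiff ?_ hs
    intro ε hε
    obtain ⟨C, D, hD, hb⟩ := ent_upper f α hα
    set m := ∫ x, x ^ 2 * f x
    have hm : 0 ≤ m := integral_nonneg fun x => mul_nonneg (sq_nonneg _) (hf0 x)
    -- `log A ≤ A / a + log a - 1` with `a = 2 (D + 1) / ε`
    set a := 2 * (D + 1) / ε with ha
    have ha0 : 0 < a := by positivity
    refine ⟨C + D * ((1 + 2 * m) / a + Real.log a - 1), 1, fun t ht => ?_⟩
    have ht0 : 0 < t := by linarith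
    obtain ⟨h1, h2, h3, h4, h5, _⟩ := hH t ht0
    have h6 := hb t (1 + 2 * m + 2 * t) (htα t ht0) (by linarith) h1 h2 h3 h4 (by linarith)
    have hA0 : 0 < 1 + 2 * m + 2 * t := by linarith
    have h7 := Real.log_le_sub_one_of_pos (x := (1 + 2 * m + 2 * t) / a) (by positivity)
    rw [Real.log_div hA0.ne' ha0.ne', add_div] at h7
    have h8 : Real.log (1 + 2 * m + 2 * t) ≤
        ((1 + 2 * m) / a + Real.log a - 1) + 2 * t / a := by linarith
    have h9 := mul_le_mul_of_nonneg_left h8 hD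
    have h10 : D * (2 * t / a) ≤ ε * t := by
      have : D * (2 * t / a) = (D / (D + 1)) * (ε * t) := by rw [ha]; field_simp
      rw [this]
      refine mul_le_of_le_one_left (by positivity) ?_
      rw [div_le_one (by linarith)]
      linarith
    linarith
end
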